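/- arXiv:2009.05357 — 8 statements merged into one kernel-verified Lean document; each statement's English description precedes it below -/
import Mathlib

section
/- The list of four quadrics q0, q1, q2, q3 is a regular sequence in the polynomial ring ℚ[a^(0)_(0,1), a^(0)_(0,2), a^(0)_(0,3), a^(1)_(0,1), a^(1)_(1,2), a^(1)_(1,3), a^(2)_(0,2), a^(2)_(1,2), a^(2)_(2,3), a^(3)_(0,3), a^(3)_(1,3), a^(3)_(2,3)] in 12 variables; in particular the projective scheme Q = V(q0,q1,q2,q3) ⊂ ℙ¹¹ is a complete intersection of codimension 4. -/
/-!
The four quadrics `q0, q1, q2, q3` from the unfolding construction of numerical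
Godeaux surfaces form a regular sequence in the polynomial ring over `ℚ` in the
12 variables `a^(k)_(i,j)` (`0 ≤ i < j ≤ 3`, `k ∈ {i,j}`).

Variable indexing (`Fin 12`):
0 ↦ a^(3)_(2,3), 1 ↦ a^(3)_(1,3), 2 ↦ a^(3)_(0,3), 3 ↦ a^(2)_(2,3),
4 ↦ a^(2)_(1,2), 5 ↦ a^(2)_(0,2), 6 ↦ a^(1)_(1,3), 7 ↦ a^(1)_(1,2),
8 ↦ a^(1)_(0,1), 9 ↦ a^(0)_(0,3), 10 ↦ a^(0)_(0,2), 11 ↦ a^(0)_(0,1).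
-/

open MvPolynomial

/-- `q0 = a^(1)_(1,2)·a^(1)_(1,3) − a^(2)_(1,2)·a^(2)_(2,3) + a^(3)_(1,3)·a^(3)_(2,3)`. -/
noncomputable def godeauxQ0 : MvPolynomial (Fin 12) ℚ := X 7 * X 6 - X 4 * X 3 + X 1 * X 0

/-- `q1 = a^(0)_(0,2)·a^(0)_(0,3) − a^(3)_(0,3)·a^(3)_(2,3) + a^(2)_(0,2)·a^(2)_(2,3)`. -/
noncomputable def godeauxQ1 : MvPolynomial (Fin 12) ℚ := X 10 * X 9 - X 2 * X 0 + X 5 * X 3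

/-- `q2 = a^(1)_(0,1)·a^(1)_(1,3) − a^(0)_(0,1)·a^(0)_(0,3) + a^(3)_(0,3)·a^(3)_(1,3)`. -/
noncomputable def godeauxQ2 : MvPolynomial (Fin 12) ℚ := X 8 * X 6 - X 11 * X 9 + X 2 * X 1

/-- `q3 = a^(0)_(0,1)·a^(0)_(0,2) − a^(1)_(0,1)·a^(1)_(1,2) + a^(2)_(0,2)·a^(2)_(1,2)`. -/
noncomputable def godeauxQ3 : MvPolynomial (Fin 12) ℚ := X 11 * X 10 - X 8 * X 7 + X 5 * X 4

/-!
Modulo the variables `X 0, X 4, X 8, X 9` the quadrics become the pairwise coprime monomials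
`X 7 * X 6`, `X 5 * X 3`, `X 2 * X 1`, `X 11 * X 10`. Hence the four variables followed by the four
quadrics form a weakly regular sequence, and homogeneity allows permuting it.
-/

namespace MvPolynomial

open RingTheory.Sequence
open scoped Pointwise

section

attribute [local instance] MvPolynomial.gradedAlgebra

/-- The graded Nakayama lemma for submodules of a graded cyclic module. -/
theorem eq_bot_of_eq_smul_of_isHomogeneous {σ R : Type*} [CommRing R]
    {I : Ideal (MvPolynomial σ R)} (hI : I.IsHomogeneous (homogeneousSubmodule σ R))
    {a : MvPolynomial σ R} (ha : a ∈ idealOfVars σ R)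
    {K : Submodule (MvPolynomial σ R) (MvPolynomial σ R ⧸ I)} (hK : K = a • K) : K = ⊥ := by
  have hpow : ∀ (n : ℕ), ∀ x ∈ K, ∃ y ∈ K, a ^ n • y = x := by
    intro n
    induction n with
    | zero => exact fun x hx => ⟨x, hx, by simp⟩
    | succ n ih =>
      intro x hx
      obtain ⟨y, hy, rfl⟩ := ih x hx
      rw [hK] at hy
      obtain ⟨z, hz, rfl⟩ := Submodule.mem_smul_pointwise_iff_exists _ _ _ |>.mp hy
      exact ⟨z, hz, by rw [pow_succ, mul_smul]⟩
  refine (Submodule.eq_bot_iff K).mpr fun x hx => ?_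
  obtain ⟨p, rfl⟩ := Ideal.Quotient.mk_surjective x
  rw [Ideal.Quotient.eq_zero_iff_mem, mem_iff_homogeneousComponent_mem hI]
  intro n
  obtain ⟨y, -, hy⟩ := hpow (n + 1) _ hx
  obtain ⟨q, rfl⟩ := Ideal.Quotient.mk_surjective y
  have hsub : p - a ^ (n + 1) * q ∈ I := by
    rw [← Ideal.Quotient.eq, ← hy]
    rfl
  have hzero : homogeneousComponent n (a ^ (n + 1) * q) = 0 := by
    have hmem : a ^ (n + 1) * q ∈ idealOfVars σ R ^ (n + 1) :=
      Ideal.mul_mem_right _ _ (Ideal.pow_mem_pow ha _)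
    rw [mem_pow_idealOfVars_iff] at hmem
    refine homogeneousComponent_eq_zero' _ _ fun d hd => ?_
    have := hmem d hd
    omega
  simpa [hzero] using (mem_iff_homogeneousComponent_mem hI _).mp hsub n

theorem isWeaklyRegular_of_perm_of_isHomogeneous {σ R : Type*} [CommRing R]
    {rs rs' : List (MvPolynomial σ R)} (h : IsWeaklyRegular (MvPolynomial σ R) rs)
    (hperm : rs.Perm rs') (hrs : ∀ r ∈ rs, ∃ n, 0 < n ∧ r.IsHomogeneous n) :
    IsWeaklyRegular (MvPolynomial σ R) rs' := by
  refine h.prototype_perm hperm fun a b ts hts => ?_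
  intro K hK
  have hsub := hts.subset
  obtain ⟨n, hn, ha⟩ := hrs a (hsub (by simp))
  refine eq_bot_of_eq_smul_of_isHomogeneous ?_ ?_ hK
  · rw [smul_eq_mul, Ideal.mul_top]
    refine Ideal.homogeneous_span _ _ fun r hr => ?_
    obtain ⟨m, -, hm⟩ := hrs r (hsub (List.mem_cons_of_mem _ (List.mem_cons_of_mem _ hr)))
    exact ⟨m, hm⟩
  · rw [← pow_one (idealOfVars σ R), mem_pow_idealOfVars_iff]
    intro d hd
    by_contra hlt
    exact mem_support_iff.mp hd (ha.coeff_eq_zero (by omega))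

end

/-- Monomials with pairwise disjoint supports form a weakly regular sequence. -/
theorem isWeaklyRegular_map_monomial {σ R : Type*} [CommRing R] {L : List (σ →₀ ℕ)}
    (hL : L.Pairwise Disjoint) :
    IsWeaklyRegular (MvPolynomial σ R) (L.map fun s => monomial s (1 : R)) := by
  refine ⟨fun i hi => ?_⟩
  rw [isSMulRegular_quotient_iff_mem_of_smul_mem]
  intro p hp
  rw [List.length_map] at hi
  have hspan : Ideal.ofList ((L.map fun s => monomial s (1 : R)).take i) =
      Ideal.span ((fun s => monomial s (1 : R)) '' {s | s ∈ L.take i}) := by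
    rw [Ideal.ofList, ← List.map_take]
    congr 1
    ext
    simp only [List.mem_map, Set.mem_ofPred_eq, Set.mem_image]
  rw [smul_eq_mul, Ideal.mul_top, hspan, mem_ideal_span_monomial_image] at hp ⊢
  intro d hd
  obtain ⟨s, hs, hle⟩ := hp (L[i] + d) (by
    simpa [mem_support_iff, coeff_monomial_mul] using hd)
  refine ⟨s, hs, ?_⟩
  have hdisj : Disjoint s L[i] := by
    obtain ⟨j, hj, rfl⟩ := List.mem_iff_getElem.mp hs
    rw [List.length_take] at hj
    rw [List.getElem_take]
    exact List.pairwise_iff_getElem.mp hL j i (by omega) hi (by omega)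
  intro k
  have hk := hle k
  have hmin := DFunLike.congr_fun hdisj.eq_bot k
  simp only [Finsupp.inf_apply, bot_eq_zero, Finsupp.zero_apply, Finsupp.add_apply] at hk hmin
  omega

end MvPolynomial

theorem godeaux_quadrics_isHomogeneous :
    ∀ q ∈ [godeauxQ0, godeauxQ1, godeauxQ2, godeauxQ3], q.IsHomogeneous 2 := by
  have hX (i j : Fin 12) : (X i * X j : MvPolynomial (Fin 12) ℚ).IsHomogeneous 2 :=
    (isHomogeneous_X ℚ i).mul (isHomogeneous_X ℚ j)
  simp only [List.forall_mem_cons, godeauxQ0, godeauxQ1, godeauxQ2, godeauxQ3]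
  exact ⟨((hX _ _).sub (hX _ _)).add (hX _ _), ((hX _ _).sub (hX _ _)).add (hX _ _),
    ((hX _ _).sub (hX _ _)).add (hX _ _), ((hX _ _).sub (hX _ _)).add (hX _ _), by simp⟩

theorem isWeaklyRegular_variables_append_godeaux_quadrics :
    RingTheory.Sequence.IsWeaklyRegular (MvPolynomial (Fin 12) ℚ)
      ([X 0, X 4, X 8, X 9] ++ [godeauxQ0, godeauxQ1, godeauxQ2, godeauxQ3]) := by
  let e (i : Fin 12) : Fin 12 →₀ ℕ := Finsupp.single i 1
  have hmon : RingTheory.Sequence.IsWeaklyRegular (MvPolynomial (Fin 12) ℚ)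
      (([X 0, X 4, X 8, X 9] : List (MvPolynomial (Fin 12) ℚ)) ++
        [X 7 * X 6, X 5 * X 3, X 2 * X 1, X 11 * X 10]) := by
    have hdisj : [e 0, e 4, e 8, e 9, e 7 + e 6, e 5 + e 3, e 2 + e 1, e 11 + e 10].Pairwise
        Disjoint := by
      have he {i j : Fin 12} (hij : i ≠ j) : Disjoint (e i) (e j) := by
        rw [Finsupp.disjoint_iff]
        exact Finsupp.support_single_disjoint one_ne_zero one_ne_zero |>.mpr hij
      have hadd (s t u : Fin 12 →₀ ℕ) : Disjoint (s + t) u ↔ Disjoint s u ∧ Disjoint t u := by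
        refine ⟨fun h => ⟨h.mono_left le_self_add, h.mono_left le_add_self⟩, fun ⟨hs, ht⟩ => ?_⟩
        rw [Finsupp.disjoint_iff] at *
        exact (Finset.disjoint_union_left.mpr ⟨hs, ht⟩).mono_left Finsupp.support_add
      simp [he, hadd, disjoint_comm (b := _ + _)]
    simpa [e, X, monomial_mul] using isWeaklyRegular_map_monomial (R := ℚ) hdisj
  rw [RingTheory.Sequence.isWeaklyRegular_append_iff'] at hmon ⊢
  refine ⟨hmon.1, ?_⟩
  convert hmon.2 using 1
  have hmem (i : Fin 12) (hi : i ∈ [0, 4, 8, 9]) :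
      Ideal.Quotient.mk (Ideal.ofList [X 0, X 4, X 8, (X 9 : MvPolynomial (Fin 12) ℚ)]) (X i) = 0 :=
    Ideal.Quotient.eq_zero_iff_mem.mpr (Ideal.subset_span (List.mem_map_of_mem (f := X) hi))
  simp [godeauxQ0, godeauxQ1, godeauxQ2, godeauxQ3, hmem 0, hmem 4, hmem 8, hmem 9]

/-- The list of quadrics `[q0, q1, q2, q3]` is a regular sequence in
`ℚ[a^(k)_(i,j)]`; in particular `Q = V(q0,q1,q2,q3) ⊂ ℙ¹¹` is a complete
intersection of codimension 4. -/
theorem godeaux_quadrics_isRegular_sequence :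
    RingTheory.Sequence.IsRegular (MvPolynomial (Fin 12) ℚ)
      [godeauxQ0, godeauxQ1, godeauxQ2, godeauxQ3] := by
  refine ⟨?_, fun htop => ?_⟩
  · have hperm := isWeaklyRegular_of_perm_of_isHomogeneous
      isWeaklyRegular_variables_append_godeaux_quadrics List.perm_append_comm fun r hr => by
        rcases List.mem_append.mp hr with hr | hr
        · refine ⟨1, one_pos, ?_⟩
          simp only [List.mem_cons, List.not_mem_nil, or_false] at hr
          rcases hr with rfl | rfl | rfl | rfl <;> exact isHomogeneous_X _ _
        · exact ⟨2, two_pos, godeaux_quadrics_isHomogeneous r hr⟩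
    exact ((RingTheory.Sequence.isWeaklyRegular_append_iff _ _ _).mp hperm).1
  · rw [smul_eq_mul, Ideal.mul_top] at htop
    have hle : Ideal.ofList [godeauxQ0, godeauxQ1, godeauxQ2, godeauxQ3] ≤
        RingHom.ker (constantCoeff (σ := Fin 12) (R := ℚ)) := by
      refine Ideal.span_le.mpr fun q hq => ?_
      exact (godeaux_quadrics_isHomogeneous q hq).coeff_eq_zero (by simp)
    exact RingHom.ker_ne_top _ (top_le_iff.mp (htop.le.trans hle))
end

section
/- In the polynomial ring ℚ[a^(k)_(i,j)] in 12 variables, the ideal generated by q0, q1, q2, q3 together with all 4×4 minors of the 4×12 Jacobian matrix (∂q_i/∂a^(k)_(i,j)) has height 8; equivalently, the singular locus of the complete intersection Q = V(q0,…,q3) has codimension 8 in ℙ¹¹. -/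
/-!
The singular locus of the Godeaux complete intersection `Q = V(q0,…,q3) ⊂ ℙ¹¹`
has codimension 8: the ideal generated by `q0, q1, q2, q3` together with all
`4×4` minors of the `4×12` Jacobian matrix `(∂q_i/∂a^(k)_(i,j))` has height 8
in `ℚ[a^(k)_(i,j)]`.

Variable indexing (`Fin 12`):
0 ↦ a^(3)_(2,3), 1 ↦ a^(3)_(1,3), 2 ↦ a^(3)_(0,3), 3 ↦ a^(2)_(2,3),
4 ↦ a^(2)_(1,2), 5 ↦ a^(2)_(0,2), 6 ↦ a^(1)_(1,3), 7 ↦ a^(1)_(1,2),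
8 ↦ a^(1)_(0,1), 9 ↦ a^(0)_(0,3), 10 ↦ a^(0)_(0,2), 11 ↦ a^(0)_(0,1).
-/

open MvPolynomial

/-- The four Godeaux quadrics `q0, q1, q2, q3`. -/
noncomputable def godeauxQ : Fin 4 → MvPolynomial (Fin 12) ℚ :=
  ![X 7 * X 6 - X 4 * X 3 + X 1 * X 0,
    X 10 * X 9 - X 2 * X 0 + X 5 * X 3,
    X 8 * X 6 - X 11 * X 9 + X 2 * X 1,
    X 11 * X 10 - X 8 * X 7 + X 5 * X 4]

/-- The `4×12` Jacobian matrix of the quadrics: the `(i,m)`-entry is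
`∂q_i/∂(m-th variable)`. -/
noncomputable def godeauxJacobian : Matrix (Fin 4) (Fin 12) (MvPolynomial (Fin 12) ℚ) :=
  Matrix.of fun i m => MvPolynomial.pderiv m (godeauxQ i)

/-- The height of an ideal: the infimum of the heights (in the prime spectrum)
of the primes containing it. -/
noncomputable def idealHeight {R : Type*} [CommRing R] (I : Ideal R) : ℕ∞ :=
  ⨅ (P : PrimeSpectrum R) (_ : I ≤ P.asIdeal), Order.height P

/-- If all maximal minors of a matrix over a field vanish, its rows are linearly dependent. -/
lemma exists_vecMul_eq_zero_of_minors {K n : Type*} [Field K] [Fintype n] {r : ℕ}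
    (A : Matrix (Fin r) n K)
    (h : ∀ c : Fin r → n, Function.Injective c → (A.submatrix id c).det = 0) :
    ∃ l : Fin r → K, l ≠ 0 ∧ Matrix.vecMul l A = 0 := by
  by_contra! hne
  have hrows : LinearIndependent K A.row := by
    rw [← Matrix.vecMul_injective_iff, ← Matrix.coe_vecMulLinear,
      injective_iff_map_eq_zero]
    exact fun l hl => by_contra fun hl0 => hne l hl0 hl
  have hrank : Module.finrank K (Submodule.span K (Set.range A.col)) = r := by
    rw [← Matrix.rank_eq_finrank_span_cols, hrows.rank_matrix, Fintype.card_fin]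
  have hcols := Submodule.exists_fun_fin_finrank_span_eq K (Set.range A.col)
  rw [hrank] at hcols
  obtain ⟨f, hf, -, hli⟩ := hcols
  choose c hc using hf
  have hcol : (A.submatrix id c).col = f := funext hc
  refine (Matrix.isUnit_iff_isUnit_det _).mp
    (Matrix.linearIndependent_cols_iff_isUnit.mp (hcol ▸ hli)) |>.ne_zero (h c ?_)
  intro i j hij
  exact hli.injective (by rw [← hc i, ← hc j, hij])

namespace MvPolynomial

section KillVars

variable {σ R : Type*} [CommRing R] [DecidableEq σ]

/-- The endomorphism of the polynomial ring that sends the variables in `s` to zero. -/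
noncomputable def killVars (s : Finset σ) : MvPolynomial σ R →ₐ[R] MvPolynomial σ R :=
  aeval fun i => if i ∈ s then 0 else X i

@[simp]
lemma killVars_X (s : Finset σ) (i : σ) :
    killVars s (X i : MvPolynomial σ R) = if i ∈ s then 0 else X i := by
  simp [killVars]

lemma sub_killVars_mem {s : Finset σ} {I : Ideal (MvPolynomial σ R)}
    (h : ∀ i ∈ s, X i ∈ I) (g : MvPolynomial σ R) : g - killVars s g ∈ I := by
  have key : Ideal.Quotient.mkₐ R I = (Ideal.Quotient.mkₐ R I).comp (killVars s) := by
    ext i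
    by_cases hi : i ∈ s
    · simpa [hi] using Ideal.Quotient.eq_zero_iff_mem.mpr (h i hi)
    · simp [hi]
  exact Ideal.Quotient.eq.mp (DFunLike.congr_fun key g)

variable [IsDomain R]

/-- The prime ideal generated by the variables in `s`, as a point of the prime spectrum. -/
noncomputable def varsPrime (s : Finset σ) : PrimeSpectrum (MvPolynomial σ R) :=
  ⟨RingHom.ker (killVars s), RingHom.ker_isPrime _⟩

lemma mem_varsPrime {s : Finset σ} {g : MvPolynomial σ R} :
    g ∈ (varsPrime s).asIdeal ↔ killVars s g = 0 :=
  Iff.rfl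

lemma varsPrime_le {s : Finset σ} {I : Ideal (MvPolynomial σ R)} (h : ∀ i ∈ s, X i ∈ I) :
    (varsPrime s).asIdeal ≤ I := fun g hg => by
  simpa [mem_varsPrime.mp hg] using sub_killVars_mem h g

lemma card_le_height_varsPrime (s : Finset σ) :
    (s.card : ℕ∞) ≤ Order.height (varsPrime s : PrimeSpectrum (MvPolynomial σ R)) := by
  induction s using Finset.induction_on with
  | empty => simp
  | insert a s ha ih =>
    have hlt : (varsPrime s : PrimeSpectrum (MvPolynomial σ R)) < varsPrime (insert a s) := by
      refine lt_of_le_of_ne (varsPrime_le fun i hi => ?_) fun heq => ?_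
      · simp [mem_varsPrime, hi]
      · have hmem : (X a : MvPolynomial σ R) ∈ (varsPrime (insert a s)).asIdeal := by
          simp [mem_varsPrime]
        rw [← heq, mem_varsPrime] at hmem
        simp [ha] at hmem
    rw [Finset.card_insert_of_notMem ha, Nat.cast_add, Nat.cast_one]
    exact (add_le_add_left ih 1).trans (Order.height_add_one_le hlt)

lemma card_le_height_of_X_mem {P : PrimeSpectrum (MvPolynomial σ R)} {s : Finset σ}
    (h : ∀ i ∈ s, X i ∈ P.asIdeal) : (s.card : ℕ∞) ≤ Order.height P :=
  (card_le_height_varsPrime s).trans (Order.height_mono (varsPrime_le h))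

lemma height_varsPrime_le [Finite σ] [IsNoetherianRing R] (s : Finset σ) :
    Order.height (varsPrime s : PrimeSpectrum (MvPolynomial σ R)) ≤ s.card := by
  classical
  have hspan : (varsPrime s : PrimeSpectrum (MvPolynomial σ R)).asIdeal
      = Ideal.span (s.image X : Finset (MvPolynomial σ R)) := by
    refine le_antisymm (varsPrime_le fun i hi => Ideal.subset_span ?_) (Ideal.span_le.mpr ?_)
    · exact Finset.mem_coe.mpr (Finset.mem_image_of_mem X hi)
    · intro g hg
      obtain ⟨i, hi, rfl⟩ := Finset.mem_image.mp (Finset.mem_coe.mp hg)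
      simp [mem_varsPrime, Finset.mem_coe.mp hi]
  have hmin : (varsPrime s : PrimeSpectrum (MvPolynomial σ R)).asIdeal
      ∈ (Ideal.span (s.image X : Finset (MvPolynomial σ R)) : Ideal _).minimalPrimes := by
    rw [← hspan, Ideal.minimalPrimes_eq_subsingleton_self]
    rfl
  rw [← PrimeSpectrum.height_eq_orderHeight]
  exact (Ideal.height_le_card_of_mem_minimalPrimes_span_finset hmin).trans
    (by exact_mod_cast Finset.card_image_le)

/-- A prime containing the variables in `s`, a prime element `q` not involving them, and a further
element not involving them and not divisible by `q` has height at least `s.card + 2`. -/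
lemma card_add_two_le_height {P : PrimeSpectrum (MvPolynomial σ R)} {s : Finset σ}
    (h : ∀ i ∈ s, X i ∈ P.asIdeal) {q f : MvPolynomial σ R} (hq : Prime q)
    (hqs : killVars s q = q) (hfs : killVars s f = f) (hqP : q ∈ P.asIdeal)
    (hfP : f ∈ P.asIdeal) (hqf : ¬ q ∣ f) : (s.card + 2 : ℕ∞) ≤ Order.height P := by
  have hprime : (Ideal.span {q}).IsPrime := (Ideal.span_singleton_prime hq.ne_zero).mpr hq
  let Q : PrimeSpectrum (MvPolynomial σ R) :=
    ⟨(Ideal.span {q}).comap (killVars s), Ideal.comap_isPrime _ _⟩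
  have hmemQ {g : MvPolynomial σ R} : g ∈ Q.asIdeal ↔ q ∣ killVars s g := by
    simp [Q, Ideal.mem_comap, Ideal.mem_span_singleton]
  have hsQ : varsPrime s < Q := by
    refine lt_of_le_of_ne (varsPrime_le fun i hi => by simp [hmemQ, hi]) fun heq => ?_
    have hmem : q ∈ (varsPrime s).asIdeal := by rw [heq, hmemQ, hqs]
    rw [mem_varsPrime, hqs] at hmem
    exact hq.ne_zero hmem
  have hQP : Q < P := by
    refine lt_of_le_of_ne (fun g hg => ?_) fun heq => ?_
    · have hkill := Ideal.mem_of_dvd P.asIdeal (hmemQ.mp hg) hqP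
      simpa using add_mem (sub_killVars_mem h g) hkill
    · rw [← heq, hmemQ, hfs] at hfP
      exact hqf hfP
  calc (s.card + 2 : ℕ∞) = s.card + 1 + 1 := by rw [add_assoc, one_add_one_eq_two]
    _ ≤ Order.height (varsPrime s : PrimeSpectrum (MvPolynomial σ R)) + 1 + 1 := by
      gcongr
      exact card_le_height_varsPrime s
    _ ≤ Order.height Q + 1 := by
      gcongr
      exact Order.height_add_one_le hsQ
    _ ≤ Order.height P := Order.height_add_one_le hQP

end KillVars

/-- A quadric that is a signed sum of three products of distinct variables is prime. -/
lemma prime_X_mul_X_sub_add {σ K : Type*} [Field K] (v : Fin 6 → σ)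
    (hv : Function.Injective v) :
    Prime (X (v 0) * X (v 1) - X (v 2) * X (v 3) + X (v 4) * X (v 5) : MvPolynomial σ K) := by
  classical
  rw [← UniqueFactorizationMonoid.irreducible_iff_prime]
  have hne {i j : Fin 6} (h : i ≠ j) : v i ≠ v j := hv.ne h
  have heq : (X (v 0) * X (v 1) - X (v 2) * X (v 3) + X (v 4) * X (v 5) : MvPolynomial σ K)
      = X (v 0) * X (v 1) + (X (v 4) * X (v 5) - X (v 2) * X (v 3)) := by ring
  rw [heq]
  refine irreducible_mul_X_add _ _ _ (X_ne_zero _) ?_ ?_ ?_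
  · simpa using hne (by decide)
  · intro hmem
    have hmem := vars_sub_subset _ hmem
    rw [Finset.mem_union] at hmem
    rcases hmem with hmem | hmem <;> have hmem := vars_mul _ _ hmem <;>
      simp [hv.eq_iff] at hmem
  · refine (Irreducible.isRelPrime_iff_not_dvd (X_prime).irreducible).mpr ?_
    rintro ⟨g, hg⟩
    have := congrArg (eval fun j => if j = v 4 ∨ j = v 5 then (1 : K) else 0) hg
    simp [hv.eq_iff] at this

end MvPolynomial

/-- The four quadrics as polynomial functions. -/
def godeauxEval {A : Type*} [CommRing A] (x : Fin 12 → A) : Fin 4 → A :=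
  ![x 7 * x 6 - x 4 * x 3 + x 1 * x 0,
    x 10 * x 9 - x 2 * x 0 + x 5 * x 3,
    x 8 * x 6 - x 11 * x 9 + x 2 * x 1,
    x 11 * x 10 - x 8 * x 7 + x 5 * x 4]

lemma map_godeauxQ {A : Type*} [CommRing A] (φ : MvPolynomial (Fin 12) ℚ →+* A) (i : Fin 4) :
    φ (godeauxQ i) = godeauxEval (fun j => φ (X j)) i := by
  fin_cases i <;> simp [godeauxQ, godeauxEval]

/-- The Jacobian matrix of the quadrics at a point. -/
def godeauxJacobianEval {A : Type*} [CommRing A] (x : Fin 12 → A) : Matrix (Fin 4) (Fin 12) A :=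
  !![x 1, x 0, 0, -x 4, -x 3, 0, x 7, x 6, 0, 0, 0, 0;
    -x 2, 0, -x 0, x 5, 0, x 3, 0, 0, 0, x 10, x 9, 0;
    0, x 2, x 1, 0, 0, 0, x 8, 0, x 6, -x 11, 0, -x 9;
    0, 0, 0, 0, x 5, x 4, 0, -x 8, -x 7, 0, x 11, x 10]

lemma map_godeauxJacobian {A : Type*} [CommRing A] (φ : MvPolynomial (Fin 12) ℚ →+* A) :
    godeauxJacobian.map φ = godeauxJacobianEval (fun j => φ (X j)) := by
  ext i m
  fin_cases i <;> fin_cases m <;>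
    simp [godeauxJacobian, godeauxQ, godeauxJacobianEval, pderiv_X]

set_option maxHeartbeats 4000000 in
/-- A singular point of `Q` either has eight vanishing coordinates, or it lies on the subspace
spanned by the six variables of one of the quadrics and satisfies a further cubic equation. -/
lemma vanishing_of_godeaux_singular {K : Type*} [Field K] {x : Fin 12 → K} {l : Fin 4 → K}
    (hl : l ≠ 0) (hJ : Matrix.vecMul l (godeauxJacobianEval x) = 0)
    (hQ : ∀ i, godeauxEval x i = 0) :
    (∃ s : Finset (Fin 12), s.card = 8 ∧ ∀ i ∈ s, x i = 0) ∨
      ∃ v : Fin 6 → Fin 12, Function.Injective v ∧ (∀ j, (∀ i, v i ≠ j) → x j = 0) ∧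
        x (v 0) * x (v 1) - x (v 2) * x (v 3) + x (v 4) * x (v 5) = 0 ∧
        x (v 5) * x (v 1) * x (v 2) + x (v 4) * x (v 0) * x (v 3) = 0 := by
  have hl' : l 0 ≠ 0 ∨ l 1 ≠ 0 ∨ l 2 ≠ 0 ∨ l 3 ≠ 0 := by
    by_contra! h
    exact hl (funext fun i => by fin_cases i <;> simp [h])
  simp only [funext_iff, Fin.forall_iff_succ, Matrix.vecMul, dotProduct, Fin.sum_univ_four,
    godeauxJacobianEval] at hJ
  simp [godeauxEval, Fin.forall_iff_succ] at hQ hJ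
  obtain ⟨q0, q1, q2, q3⟩ := hQ
  obtain ⟨e0, e1, e2, e3, e4, e5, e6, e7, e8, e9, e10, e11⟩ := hJ
  by_cases h0 : l 0 = 0
  · by_cases h1 : l 1 = 0
    · by_cases h2 : l 2 = 0
      · by_cases h3 : l 3 = 0
        · grind
        · have hor : x 0 = 0 ∧ x 1 = 0 ∨ x 0 = 0 ∧ x 2 = 0 ∨ x 1 = 0 ∧ x 2 = 0 := by grind
          rcases hor with hx | hx | hx
          · refine Or.inl ⟨{0, 1, 4, 5, 7, 8, 10, 11}, by decide, ?_⟩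
            simp only [Finset.forall_mem_insert, Finset.mem_singleton, forall_eq]
            grind
          · refine Or.inl ⟨{0, 2, 4, 5, 7, 8, 10, 11}, by decide, ?_⟩
            simp only [Finset.forall_mem_insert, Finset.mem_singleton, forall_eq]
            grind
          · refine Or.inl ⟨{1, 2, 4, 5, 7, 8, 10, 11}, by decide, ?_⟩
            simp only [Finset.forall_mem_insert, Finset.mem_singleton, forall_eq]
            grind
      · by_cases h3 : l 3 = 0
        · have hor : x 3 = 0 ∧ x 4 = 0 ∨ x 3 = 0 ∧ x 5 = 0 ∨ x 4 = 0 ∧ x 5 = 0 := by grind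
          rcases hor with hx | hx | hx
          · refine Or.inl ⟨{1, 2, 3, 4, 6, 8, 9, 11}, by decide, ?_⟩
            simp only [Finset.forall_mem_insert, Finset.mem_singleton, forall_eq]
            grind
          · refine Or.inl ⟨{1, 2, 3, 5, 6, 8, 9, 11}, by decide, ?_⟩
            simp only [Finset.forall_mem_insert, Finset.mem_singleton, forall_eq]
            grind
          · refine Or.inl ⟨{1, 2, 4, 5, 6, 8, 9, 11}, by decide, ?_⟩
            simp only [Finset.forall_mem_insert, Finset.mem_singleton, forall_eq]
            grind
        · refine Or.inl ⟨{1, 2, 4, 5, 6, 7, 8, 11}, by decide, ?_⟩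
          simp only [Finset.forall_mem_insert, Finset.mem_singleton, forall_eq]
          grind
    · by_cases h2 : l 2 = 0
      · by_cases h3 : l 3 = 0
        · have hor : x 6 = 0 ∧ x 7 = 0 ∨ x 6 = 0 ∧ x 8 = 0 ∨ x 7 = 0 ∧ x 8 = 0 := by grind
          rcases hor with hx | hx | hx
          · refine Or.inl ⟨{0, 2, 3, 5, 6, 7, 9, 10}, by decide, ?_⟩
            simp only [Finset.forall_mem_insert, Finset.mem_singleton, forall_eq]
            grind
          · refine Or.inl ⟨{0, 2, 3, 5, 6, 8, 9, 10}, by decide, ?_⟩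
            simp only [Finset.forall_mem_insert, Finset.mem_singleton, forall_eq]
            grind
          · refine Or.inl ⟨{0, 2, 3, 5, 7, 8, 9, 10}, by decide, ?_⟩
            simp only [Finset.forall_mem_insert, Finset.mem_singleton, forall_eq]
            grind
        · refine Or.inl ⟨{0, 2, 3, 4, 5, 7, 8, 10}, by decide, ?_⟩
          simp only [Finset.forall_mem_insert, Finset.mem_singleton, forall_eq]
          grind
      · by_cases h3 : l 3 = 0
        · refine Or.inl ⟨{0, 1, 2, 3, 5, 6, 8, 9}, by decide, ?_⟩
          simp only [Finset.forall_mem_insert, Finset.mem_singleton, forall_eq]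
          grind
        · refine Or.inr ⟨![7, 6, 4, 3, 1, 0], by decide, ?_, ?_, ?_⟩
          · simp [Fin.forall_iff_succ]
            grind
          · simp
            grind
          · simp
            grind
  · by_cases h1 : l 1 = 0
    · by_cases h2 : l 2 = 0
      · by_cases h3 : l 3 = 0
        · have hor : x 9 = 0 ∧ x 10 = 0 ∨ x 9 = 0 ∧ x 11 = 0 ∨ x 10 = 0 ∧ x 11 = 0 := by grind
          rcases hor with hx | hx | hx
          · refine Or.inl ⟨{0, 1, 3, 4, 6, 7, 9, 10}, by decide, ?_⟩
            simp only [Finset.forall_mem_insert, Finset.mem_singleton, forall_eq]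
            grind
          · refine Or.inl ⟨{0, 1, 3, 4, 6, 7, 9, 11}, by decide, ?_⟩
            simp only [Finset.forall_mem_insert, Finset.mem_singleton, forall_eq]
            grind
          · refine Or.inl ⟨{0, 1, 3, 4, 6, 7, 10, 11}, by decide, ?_⟩
            simp only [Finset.forall_mem_insert, Finset.mem_singleton, forall_eq]
            grind
        · refine Or.inl ⟨{0, 1, 3, 4, 5, 7, 10, 11}, by decide, ?_⟩
          simp only [Finset.forall_mem_insert, Finset.mem_singleton, forall_eq]
          grind
      · by_cases h3 : l 3 = 0
        · refine Or.inl ⟨{0, 1, 2, 3, 4, 6, 9, 11}, by decide, ?_⟩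
          simp only [Finset.forall_mem_insert, Finset.mem_singleton, forall_eq]
          grind
        · refine Or.inr ⟨![10, 9, 0, 2, 3, 5], by decide, ?_, ?_, ?_⟩
          · simp [Fin.forall_iff_succ]
            grind
          · simp
            grind
          · simp
            grind
    · by_cases h2 : l 2 = 0
      · by_cases h3 : l 3 = 0
        · refine Or.inl ⟨{0, 1, 2, 3, 6, 7, 9, 10}, by decide, ?_⟩
          simp only [Finset.forall_mem_insert, Finset.mem_singleton, forall_eq]
          grind
        · refine Or.inr ⟨![6, 8, 9, 11, 2, 1], by decide, ?_, ?_, ?_⟩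
          · simp [Fin.forall_iff_succ]
            grind
          · simp
            grind
          · simp
            grind
      · by_cases h3 : l 3 = 0
        · refine Or.inr ⟨![11, 10, 8, 7, 5, 4], by decide, ?_, ?_, ?_⟩
          · simp [Fin.forall_iff_succ]
            grind
          · simp
            grind
          · simp
            grind
        · refine Or.inl ⟨{0, 1, 2, 3, 4, 5, 6, 7}, by decide, ?_⟩
          simp only [Finset.forall_mem_insert, Finset.mem_singleton, forall_eq]
          grind

/-- The ideal generated by `q0,…,q3` and the `4×4` minors of the Jacobian matrix
has height 8; i.e. the singular locus of `Q` has codimension 8 in `ℙ¹¹`. -/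
theorem godeaux_singular_locus_height :
    idealHeight (Ideal.span
      (Set.range godeauxQ ∪
        {d : MvPolynomial (Fin 12) ℚ | ∃ c : Fin 4 → Fin 12, Function.Injective c ∧
          d = (godeauxJacobian.submatrix id c).det})) = 8 := by
  refine le_antisymm ?_ (le_iInf₂ fun P hP => ?_)
  · refine (iInf₂_le (varsPrime {0, 1, 4, 5, 7, 8, 10, 11}) (Ideal.span_le.mpr ?_)).trans
      (height_varsPrime_le _)
    rintro _ (⟨i, rfl⟩ | ⟨c, -, rfl⟩)
    · rw [SetLike.mem_coe, mem_varsPrime, ← AlgHom.coe_toRingHom, map_godeauxQ]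
      fin_cases i <;> simp [godeauxEval]
    · rw [SetLike.mem_coe, mem_varsPrime, ← AlgHom.coe_toRingHom, RingHom.map_det]
      refine Matrix.det_eq_zero_of_row_eq_zero 3 fun j => ?_
      rw [RingHom.mapMatrix_apply, ← Matrix.submatrix_map, map_godeauxJacobian]
      simp only [Matrix.submatrix_apply, id]
      generalize c j = m
      fin_cases m <;> simp [godeauxJacobianEval]
  · let φ := (algebraMap _ (FractionRing (MvPolynomial (Fin 12) ℚ ⧸ P.asIdeal))).comp
      (Ideal.Quotient.mk P.asIdeal)
    have hφ {g : MvPolynomial (Fin 12) ℚ} : φ g = 0 ↔ g ∈ P.asIdeal := by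
      simp [φ, FaithfulSMul.algebraMap_eq_zero_iff, Ideal.Quotient.eq_zero_iff_mem]
    obtain ⟨l, hl, hJ⟩ := exists_vecMul_eq_zero_of_minors (godeauxJacobian.map φ) fun c hc => by
      rw [Matrix.submatrix_map, ← RingHom.mapMatrix_apply, ← RingHom.map_det, hφ]
      exact hP (Ideal.subset_span (Or.inr ⟨c, hc, rfl⟩))
    rw [map_godeauxJacobian] at hJ
    rcases vanishing_of_godeaux_singular hl hJ fun i => by
      rw [← map_godeauxQ, hφ]
      exact hP (Ideal.subset_span (Or.inl ⟨i, rfl⟩)) with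
      ⟨s, hs, hx⟩ | ⟨v, hv, hx, hq, hf⟩
    · simpa [hs] using card_le_height_of_X_mem fun i hi => hφ.mp (hx i hi)
    · simp only [← map_mul, ← map_sub, ← map_add, hφ] at hq hf
      have hcard : (Finset.univ.image v)ᶜ.card = 6 := by
        simp [Finset.card_compl, Finset.card_image_of_injective _ hv]
      have hheight := card_add_two_le_height (s := (Finset.univ.image v)ᶜ)
        (fun j hj => hφ.mp (hx j (by simpa using hj))) (prime_X_mul_X_sub_add v hv)
        (by simp) (by simp) hq hf ?_
      · rw [hcard] at hheight
        norm_num at hheight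
        exact hheight
      · rintro ⟨g, hg⟩
        have := congrArg (eval fun j => if j = v 4 then (0 : ℚ) else 1) hg
        simp [hv.eq_iff] at this
end

section
/- In the polynomial ring k[y0,y1,y2,y3] over a commutative ring k, the ideal J generated by the six products y_i·y_j with 0 ≤ i < j ≤ 3 equals the intersection of the four ideals J_i, i = 0,…,3, where J_i is the ideal generated by the three variables y_j with j ≠ i. (Geometrically, J is the homogeneous ideal of the four coordinate points of ℙ³.) -/
/-!
In `k[y0,y1,y2,y3]` over a commutative ring `k`, the ideal `J` generated by
the six products `y_i·y_j` (`0 ≤ i < j ≤ 3`) equals the intersection of the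
four ideals `J_i = (y_j | j ≠ i)`. Geometrically, `J` is the homogeneous ideal
of the four coordinate points of `ℙ³`.
-/

open MvPolynomial

/-- A polynomial lies in the ideal generated by the products of two distinct variables iff each of
its monomials involves two distinct variables. -/
theorem mem_span_X_mul_X_iff {σ R : Type*} [LinearOrder σ] [CommRing R] {p : MvPolynomial σ R} :
    p ∈ Ideal.span {q : MvPolynomial σ R | ∃ i j : σ, i < j ∧ q = X i * X j} ↔
      ∀ m ∈ p.support, ∃ i j : σ, i < j ∧ m i ≠ 0 ∧ m j ≠ 0 := by
  have himage : {q : MvPolynomial σ R | ∃ i j : σ, i < j ∧ q = X i * X j} =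
      (fun s => monomial s (1 : R)) ''
        {s | ∃ i j : σ, i < j ∧ s = Finsupp.single i 1 + Finsupp.single j 1} := by
    ext q
    constructor
    · rintro ⟨i, j, hij, rfl⟩
      exact ⟨_, ⟨i, j, hij, rfl⟩, by simp [X, monomial_mul]⟩
    · rintro ⟨_, ⟨i, j, hij, rfl⟩, rfl⟩
      exact ⟨i, j, hij, by simp [X, monomial_mul]⟩
  rw [himage, mem_ideal_span_monomial_image]
  refine forall₂_congr fun m _ => ?_
  constructor
  · rintro ⟨_, ⟨i, j, hij, rfl⟩, hle⟩
    have hi := hle i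
    have hj := hle j
    simp only [Finsupp.add_apply, Finsupp.single_eq_same] at hi hj
    exact ⟨i, j, hij, by omega, by omega⟩
  · rintro ⟨i, j, hij, hi, hj⟩
    refine ⟨_, ⟨i, j, hij, rfl⟩, fun l => ?_⟩
    rw [Finsupp.add_apply, Finsupp.single_apply, Finsupp.single_apply]
    have := hij.ne
    grind

/-- A polynomial lies in the ideal generated by all variables other than `X i` iff each of its
monomials involves such a variable. -/
theorem mem_span_X_ne_iff {σ R : Type*} [CommRing R] {i : σ} {p : MvPolynomial σ R} :
    p ∈ Ideal.span {q : MvPolynomial σ R | ∃ j : σ, j ≠ i ∧ q = X j} ↔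
      ∀ m ∈ p.support, ∃ j, j ≠ i ∧ m j ≠ 0 := by
  have himage : {q : MvPolynomial σ R | ∃ j : σ, j ≠ i ∧ q = X j} = X '' {j | j ≠ i} := by
    ext q
    simp [eq_comm]
  rw [himage, mem_ideal_span_X_image]
  rfl

/-- `(y_i y_j | 0 ≤ i < j ≤ 3) = ⋂_{i=0}^{3} (y_j | j ≠ i)`. -/
theorem coordinate_points_ideal (k : Type*) [CommRing k] :
    Ideal.span {p : MvPolynomial (Fin 4) k | ∃ i j : Fin 4, i < j ∧ p = X i * X j} =
      ⨅ i : Fin 4,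
        Ideal.span {p : MvPolynomial (Fin 4) k | ∃ j : Fin 4, j ≠ i ∧ p = X j} := by
  ext p
  simp only [Ideal.mem_iInf, mem_span_X_mul_X_iff, mem_span_X_ne_iff]
  constructor
  · intro h l m hm
    obtain ⟨i, j, hij, hi, hj⟩ := h m hm
    by_cases hil : i = l
    · exact ⟨j, fun hjl => hij.ne (hil.trans hjl.symm), hj⟩
    · exact ⟨i, hil, hi⟩
  · intro h m hm
    obtain ⟨i, -, hi⟩ := h 0 m hm
    obtain ⟨j, hji, hj⟩ := h i m hm
    rcases hji.lt_or_gt with hlt | hgt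
    · exact ⟨j, i, hlt, hj, hi⟩
    · exact ⟨i, j, hgt, hi, hj⟩
end

section
/- In the quotient ring ℚ[a^(k)_(i,j)]/(q0,q1,q2,q3) of the 12-variable polynomial ring by the ideal of the four quadrics, for each row of the a-matrix the images of its three nonzero entries form a regular sequence. Explicitly, each of the four triples (a^(0)_(0,1), a^(0)_(0,2), a^(0)_(0,3)), (a^(1)_(0,1), a^(1)_(1,2), a^(1)_(1,3)), (a^(2)_(0,2), a^(2)_(1,2), a^(2)_(2,3)), (a^(3)_(0,3), a^(3)_(1,3), a^(3)_(2,3)) is a regular sequence in ℚ[a^(k)_(i,j)]/(q0,q1,q2,q3). -/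
/-!
In the quotient ring `S_Q = ℚ[a^(k)_(i,j)]/(q0,q1,q2,q3)`, the images of the
three nonzero entries of each row of the `a`-matrix form a regular sequence.

Variable indexing (`Fin 12`):
0 ↦ a^(3)_(2,3), 1 ↦ a^(3)_(1,3), 2 ↦ a^(3)_(0,3), 3 ↦ a^(2)_(2,3),
4 ↦ a^(2)_(1,2), 5 ↦ a^(2)_(0,2), 6 ↦ a^(1)_(1,3), 7 ↦ a^(1)_(1,2),
8 ↦ a^(1)_(0,1), 9 ↦ a^(0)_(0,3), 10 ↦ a^(0)_(0,2), 11 ↦ a^(0)_(0,1).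

Row 0 of the `a`-matrix has nonzero entries `a^(0)_(0,1), a^(0)_(0,2), a^(0)_(0,3)`,
row 1 has `a^(1)_(0,1), a^(1)_(1,2), a^(1)_(1,3)`,
row 2 has `a^(2)_(0,2), a^(2)_(1,2), a^(2)_(2,3)`,
row 3 has `a^(3)_(0,3), a^(3)_(1,3), a^(3)_(2,3)`.
-/

open MvPolynomial

/-- The ideal of the four Godeaux quadrics in `ℚ[a^(k)_(i,j)]`. -/
noncomputable def godeauxQIdeal : Ideal (MvPolynomial (Fin 12) ℚ) :=
  Ideal.span
    {X 7 * X 6 - X 4 * X 3 + X 1 * X 0,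
     X 10 * X 9 - X 2 * X 0 + X 5 * X 3,
     X 8 * X 6 - X 11 * X 9 + X 2 * X 1,
     X 11 * X 10 - X 8 * X 7 + X 5 * X 4}

/-- The quotient ring `S_Q = ℚ[a^(k)_(i,j)]/(q0,q1,q2,q3)`. -/
noncomputable abbrev godeauxSQ : Type :=
  MvPolynomial (Fin 12) ℚ ⧸ godeauxQIdeal

/-- The image in `S_Q` of the `m`-th variable. -/
noncomputable def abar (m : Fin 12) : godeauxSQ :=
  Ideal.Quotient.mk godeauxQIdeal (X m)

/-- The list `fs` is a weakly regular sequence modulo the ideal `J`. -/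
def IsWeaklyRegularMod {R : Type*} [CommRing R] : Ideal R → List R → Prop
  | _, [] => True
  | J, f :: fs => (∀ s, f * s ∈ J → s ∈ J) ∧ IsWeaklyRegularMod (J ⊔ Ideal.span {f}) fs

namespace IsWeaklyRegularMod

section CommRing

variable {R : Type*} [CommRing R]

lemma append_iff {J : Ideal R} {fs gs : List R} :
    IsWeaklyRegularMod J (fs ++ gs) ↔
      IsWeaklyRegularMod J fs ∧ IsWeaklyRegularMod (J ⊔ Ideal.ofList fs) gs := by
  induction fs generalizing J with
  | nil => simp [IsWeaklyRegularMod]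
  | cons f fs ih => simp [IsWeaklyRegularMod, ih, and_assoc, sup_assoc]

/-- Weak regularity only depends on the residue classes of the elements. -/
lemma congr_mod {J : Ideal R} {fs gs : List R} (h : List.Forall₂ (fun f g => f - g ∈ J) fs gs)
    (hf : IsWeaklyRegularMod J fs) : IsWeaklyRegularMod J gs := by
  induction fs generalizing J gs with
  | nil => obtain rfl := List.forall₂_nil_left_iff.1 h; trivial
  | cons f fs ih =>
    obtain ⟨g, gs, hfg, htl, rfl⟩ := List.forall₂_cons_left_iff.1 h
    have hspan : J ⊔ Ideal.span {f} = J ⊔ Ideal.span {g} := by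
      apply le_antisymm <;> refine sup_le le_sup_left ?_ <;>
        rw [Ideal.span_singleton_le_iff_mem, Submodule.mem_sup]
      · exact ⟨f - g, hfg, g, Ideal.mem_span_singleton_self g, by ring⟩
      · exact ⟨g - f, by simpa using J.neg_mem hfg, f, Ideal.mem_span_singleton_self f, by ring⟩
    refine ⟨fun s hs => hf.1 s ?_, hspan ▸ ih (htl.imp fun _ _ h => Ideal.mem_sup_left h) hf.2⟩
    rw [show f * s = (f - g) * s + g * s by ring]
    exact J.add_mem (J.mul_mem_right s hfg) hs

lemma map_equiv {S : Type*} [CommRing S] (e : R ≃+* S) {J : Ideal R} {fs : List R}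
    (h : IsWeaklyRegularMod J fs) : IsWeaklyRegularMod (J.map e) (fs.map e) := by
  induction fs generalizing J with
  | nil => trivial
  | cons f fs ih =>
    refine ⟨fun s hs => ?_, ?_⟩
    · obtain ⟨t, rfl⟩ := e.surjective s
      rw [← map_mul] at hs
      obtain ⟨x, hx, hxe⟩ := (Ideal.mem_map_of_equiv e _).1 hs
      exact Ideal.mem_map_of_mem e (h.1 t (e.injective hxe ▸ hx))
    · have := ih h.2
      rwa [Ideal.map_sup, Ideal.map_span, Set.image_singleton] at this

lemma isWeaklyRegular_quotient {J : Ideal R} {fs : List R} (h : IsWeaklyRegularMod J fs) :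
    RingTheory.Sequence.IsWeaklyRegular (R ⧸ J) (fs.map (Ideal.Quotient.mk J)) := by
  refine ⟨fun i hi => ?_⟩
  have hi' : i < fs.length := by simpa using hi
  rw [← List.take_append_drop i fs, append_iff, List.drop_eq_getElem_cons hi'] at h
  have hreg := h.2.1
  rw [isSMulRegular_iff_right_eq_zero_of_smul]
  intro x hx
  obtain ⟨x, rfl⟩ := Submodule.Quotient.mk_surjective _ x
  obtain ⟨x, rfl⟩ := Ideal.Quotient.mk_surjective x
  have key : ∀ y : R, Ideal.Quotient.mk J y ∈
      (Ideal.ofList ((fs.map (Ideal.Quotient.mk J)).take i) •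
        (⊤ : Submodule (R ⧸ J) (R ⧸ J))) ↔ y ∈ J ⊔ Ideal.ofList (fs.take i) := by
    intro y
    rw [smul_eq_mul, Ideal.mul_top, ← List.map_take, ← Ideal.map_ofList, ← Ideal.mem_comap,
      Ideal.comap_map_of_surjective' _ Ideal.Quotient.mk_surjective, Ideal.mk_ker, sup_comm]
  rw [← Submodule.Quotient.mk_smul, Submodule.Quotient.mk_eq_zero, List.getElem_map,
    smul_eq_mul (α := R ⧸ J), ← map_mul, key] at hx
  rw [Submodule.Quotient.mk_eq_zero, key]
  exact hreg x hx

end CommRing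

section Homogeneous

variable {σ R : Type*} [CommRing R]

attribute [local instance] MvPolynomial.gradedAlgebra

/-- Krull intersection for homogeneous ideals. -/
lemma mem_of_forall_mem_sup_span_pow {J : Ideal (MvPolynomial σ R)}
    (hJ : J.IsHomogeneous (homogeneousSubmodule σ R)) {a s : MvPolynomial σ R} {d : ℕ}
    (ha : a.IsHomogeneous d) (hd : 0 < d) (h : ∀ n, s ∈ J ⊔ Ideal.span {a ^ n}) : s ∈ J := by
  rw [mem_iff_homogeneousComponent_mem hJ]
  intro n
  obtain ⟨j, hj, _, hb, rfl⟩ := Submodule.mem_sup.1 (h (n + 1))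
  obtain ⟨b, rfl⟩ := Ideal.mem_span_singleton'.1 hb
  have hz : homogeneousComponent n (b * a ^ (n + 1)) = 0 := by
    classical
    ext m
    rw [coeff_homogeneousComponent, coeff_zero]
    split_ifs with hm
    · rw [coeff_mul]
      refine Finset.sum_eq_zero fun x hx => ?_
      rw [(ha.pow (n + 1)).coeff_eq_zero, mul_zero]
      have hle : x.2.degree ≤ n := by
        rw [← hm, ← show x.1 + x.2 = m by simpa using hx, map_add]
        exact Nat.le_add_left _ _
      nlinarith
    · rfl
  rw [map_add, hz, add_zero]
  exact homogeneousComponent_mem_of_mem hJ hj n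

lemma isHomogeneous_sup_span_singleton {J : Ideal (MvPolynomial σ R)}
    (hJ : J.IsHomogeneous (homogeneousSubmodule σ R)) {a : MvPolynomial σ R} {d : ℕ}
    (ha : a.IsHomogeneous d) :
    (J ⊔ Ideal.span {a}).IsHomogeneous (homogeneousSubmodule σ R) :=
  hJ.sup (Ideal.homogeneous_span _ _ (by rintro _ rfl; exact ⟨d, ha⟩))

/-- Weakly regular sequences of homogeneous polynomials of positive degree can be permuted. -/
lemma perm {J : Ideal (MvPolynomial σ R)} (hJ : J.IsHomogeneous (homogeneousSubmodule σ R))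
    {fs gs : List (MvPolynomial σ R)} (hp : fs.Perm gs)
    (hd : ∀ f ∈ fs, ∃ d, 0 < d ∧ f.IsHomogeneous d) (h : IsWeaklyRegularMod J fs) :
    IsWeaklyRegularMod J gs := by
  induction hp generalizing J with
  | nil => trivial
  | cons f hp ih =>
    obtain ⟨d, -, hf⟩ := hd f (by simp)
    exact ⟨h.1, ih (isHomogeneous_sup_span_singleton hJ hf)
      (fun g hg => hd g (List.mem_cons_of_mem _ hg)) h.2⟩
  | swap b a l =>
    obtain ⟨d, hd0, ha⟩ := hd a (by simp)
    obtain ⟨h₁, h₂, h₃⟩ := h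
    have hpow (n : ℕ) : ∀ s, b * s ∈ J → s ∈ J ⊔ Ideal.span {a ^ n} := by
      induction n with
      | zero => simp
      | succ n ih =>
        intro s hs
        obtain ⟨j, hj, _, ht, rfl⟩ := Submodule.mem_sup.1 (h₂ s (Ideal.mem_sup_left hs))
        obtain ⟨t, rfl⟩ := Ideal.mem_span_singleton'.1 ht
        have hbt : b * t ∈ J := h₁ _ <| by
          rw [show a * (b * t) = b * (j + t * a) - b * j by ring]
          exact J.sub_mem hs (J.mul_mem_left b hj)
        obtain ⟨i, hi, _, hu, rfl⟩ := Submodule.mem_sup.1 (ih t hbt)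
        obtain ⟨u, rfl⟩ := Ideal.mem_span_singleton'.1 hu
        exact Submodule.mem_sup.2 ⟨j + i * a, J.add_mem hj (J.mul_mem_right a hi), u * a ^ (n + 1),
          Ideal.mem_span_singleton'.2 ⟨u, rfl⟩, by ring⟩
    refine ⟨fun s hs => mem_of_forall_mem_sup_span_pow hJ ha hd0 fun n => hpow n s hs,
      fun s hs => ?_, by rwa [sup_right_comm]⟩
    obtain ⟨j, hj, _, ht, hs⟩ := Submodule.mem_sup.1 hs
    obtain ⟨t, rfl⟩ := Ideal.mem_span_singleton'.1 ht
    have hbt : b * t ∈ J ⊔ Ideal.span {a} := by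
      refine Submodule.mem_sup.2 ⟨-j, J.neg_mem hj, s * a, Ideal.mem_span_singleton'.2 ⟨s, rfl⟩, ?_⟩
      linear_combination -hs
    obtain ⟨i, hi, _, hu, rfl⟩ := Submodule.mem_sup.1 (h₂ t hbt)
    obtain ⟨u, rfl⟩ := Ideal.mem_span_singleton'.1 hu
    refine Submodule.mem_sup.2 ⟨s - u * b, h₁ _ ?_, u * b, Ideal.mem_span_singleton'.2 ⟨u, rfl⟩,
      by ring⟩
    rw [show a * (s - u * b) = j + b * i by linear_combination -hs]
    exact J.add_mem hj (J.mul_mem_left b hi)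
  | trans hp _ ih₁ ih₂ =>
    exact ih₂ hJ (fun f hf => hd f (hp.mem_iff.2 hf)) (ih₁ hJ hd h)

end Homogeneous
end IsWeaklyRegularMod

section Elimination

variable {σ R : Type*} [CommRing R] [DecidableEq σ]

/-- The polynomial `p` seen as a univariate polynomial in the variable `X y`. -/
noncomputable def polyIn (y : σ) : MvPolynomial σ R →ₐ[R] Polynomial (MvPolynomial σ R) :=
  aeval fun i => if i = y then Polynomial.X else Polynomial.C (X i)

lemma polyIn_X (y i : σ) : polyIn y (X i : MvPolynomial σ R) =
    if i = y then Polynomial.X else Polynomial.C (X i) := by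
  simp [polyIn]

lemma eval_polyIn (y : σ) (p : MvPolynomial σ R) : (polyIn y p).eval (X y) = p := by
  have : ((Polynomial.evalRingHom (X y)).comp (polyIn y).toRingHom : MvPolynomial σ R →+* _) =
      RingHom.id _ := by
    ext i : 2
    · simp [polyIn]
    · by_cases hi : i = y <;> simp [polyIn, hi]
  exact RingHom.congr_fun this p

/-- A polynomial that is monic in a variable `X y` is a nonzerodivisor modulo an ideal generated by
polynomials that do not involve `X y`. -/
lemma mem_ofList_of_monic_polyIn {y : σ} {fs : List (MvPolynomial σ R)}
    (hfs : ∀ f ∈ fs, polyIn y f = Polynomial.C f) {f : MvPolynomial σ R}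
    (hf : (polyIn y f).Monic) {s : MvPolynomial σ R} (hs : f * s ∈ Ideal.ofList fs) :
    s ∈ Ideal.ofList fs := by
  set J := Ideal.ofList fs
  have hmap : J ≤ (J.map Polynomial.C).comap (polyIn y) :=
    Ideal.span_le.2 fun g hg => by
      show polyIn y g ∈ J.map Polynomial.C
      exact hfs g hg ▸ Ideal.mem_map_of_mem Polynomial.C (Ideal.subset_span hg : g ∈ J)
  have hmem (p : Polynomial (MvPolynomial σ R)) :
      p.map (Ideal.Quotient.mk J) = 0 ↔ p ∈ J.map Polynomial.C := by
    simp [Ideal.mem_map_C_iff, Polynomial.ext_iff, Ideal.Quotient.eq_zero_iff_mem]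
  have hs' : polyIn y s ∈ J.map Polynomial.C := by
    have := hmap hs
    rw [Ideal.mem_comap, map_mul, ← hmem, Polynomial.map_mul] at this
    rw [← hmem]
    exact ((hf.map _).mul_right_eq_zero_iff).1 this
  rw [← eval_polyIn y s, Polynomial.eval_eq_sum]
  exact J.sum_mem fun n _ => J.mul_mem_right _ (Ideal.mem_map_C_iff.1 hs' n)

end Elimination

lemma IsWeaklyRegularMod.concat {σ R : Type*} [CommRing R] [DecidableEq σ]
    {fs : List (MvPolynomial σ R)} (h : IsWeaklyRegularMod ⊥ fs) {f : MvPolynomial σ R} (y : σ)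
    (hfs : ∀ g ∈ fs, polyIn y g = Polynomial.C g) (hf : (polyIn y f).Monic) :
    IsWeaklyRegularMod ⊥ (fs ++ [f]) := by
  refine append_iff.2 ⟨h, ?_, trivial⟩
  rw [bot_sup_eq]
  exact fun s => mem_ofList_of_monic_polyIn hfs hf

/-- Each element is monic in a variable that the preceding ones do not involve. The four quadrics are
combinations of those generating `godeauxQIdeal`, reduced modulo the eight linear forms. -/
lemma triangular_weaklyRegular : IsWeaklyRegularMod (⊥ : Ideal (MvPolynomial (Fin 12) ℚ))
    [X 8 ^ 2, X 6 ^ 2 - X 8 * X 6, X 2 ^ 2 - X 6 ^ 2, X 5 ^ 2 - X 2 ^ 2, X 11, X 10, X 9,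
      X 4 - X 5, X 0 - X 2, X 1 + X 2, X 7 - X 8 - X 6, X 3 - X 5] := by
  have h : IsWeaklyRegularMod (⊥ : Ideal (MvPolynomial (Fin 12) ℚ)) [] := trivial
  have h := h.concat (f := X 8 ^ 2) 8 (by simp) (by simp [polyIn_X])
  have h := h.concat (f := X 6 ^ 2 - X 8 * X 6) 6 (by simp [polyIn_X])
    (by simp [polyIn_X]; monicity!)
  have h := h.concat (f := X 2 ^ 2 - X 6 ^ 2) 2 (by simp [polyIn_X]) (by simp [polyIn_X]; monicity!)
  have h := h.concat (f := X 5 ^ 2 - X 2 ^ 2) 5 (by simp [polyIn_X]) (by simp [polyIn_X]; monicity!)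
  have h := h.concat (f := X 11) 11 (by simp [polyIn_X]) (by simp [polyIn_X])
  have h := h.concat (f := X 10) 10 (by simp [polyIn_X]) (by simp [polyIn_X])
  have h := h.concat (f := X 9) 9 (by simp [polyIn_X]) (by simp [polyIn_X])
  have h := h.concat (f := X 4 - X 5) 4 (by simp [polyIn_X]) (by simp [polyIn_X]; monicity!)
  have h := h.concat (f := X 0 - X 2) 0 (by simp [polyIn_X]) (by simp [polyIn_X]; monicity!)
  have h := h.concat (f := X 1 + X 2) 1 (by simp [polyIn_X]) (by simp [polyIn_X]; monicity!)
  have h := h.concat (f := X 7 - X 8 - X 6) 7 (by simp [polyIn_X]) (by simp [polyIn_X]; monicity!)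
  have h := h.concat (f := X 3 - X 5) 3 (by simp [polyIn_X]) (by simp [polyIn_X]; monicity!)
  simpa using h

/-- Generators of `godeauxQIdeal` that become triangular modulo suitable linear forms. -/
lemma godeauxQIdeal_eq_ofList : godeauxQIdeal = Ideal.ofList
    [X 10 * X 9 - X 2 * X 0 + X 5 * X 3 - (X 8 * X 6 - X 11 * X 9 + X 2 * X 1) -
        (X 11 * X 10 - X 8 * X 7 + X 5 * X 4),
      X 7 * X 6 - X 4 * X 3 + X 1 * X 0 + (X 10 * X 9 - X 2 * X 0 + X 5 * X 3) -
        2 * (X 8 * X 6 - X 11 * X 9 + X 2 * X 1),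
      X 8 * X 6 - X 11 * X 9 + X 2 * X 1 - (X 7 * X 6 - X 4 * X 3 + X 1 * X 0) -
        (X 10 * X 9 - X 2 * X 0 + X 5 * X 3),
      X 10 * X 9 - X 2 * X 0 + X 5 * X 3] := by
  simp only [godeauxQIdeal, Ideal.ofList_cons, Ideal.ofList_nil, sup_bot_eq, Ideal.span_insert]
  generalize (X 7 * X 6 - X 4 * X 3 + X 1 * X 0 : MvPolynomial (Fin 12) ℚ) = p
  generalize (X 10 * X 9 - X 2 * X 0 + X 5 * X 3 : MvPolynomial (Fin 12) ℚ) = q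
  generalize (X 8 * X 6 - X 11 * X 9 + X 2 * X 1 : MvPolynomial (Fin 12) ℚ) = r
  generalize (X 11 * X 10 - X 8 * X 7 + X 5 * X 4 : MvPolynomial (Fin 12) ℚ) = t
  simp only [← Ideal.span_insert]
  apply le_antisymm <;> simp only [Ideal.span_le, Set.insert_subset_iff, Set.singleton_subset_iff,
    SetLike.mem_coe, Ideal.mem_span_insert', Ideal.mem_span_singleton']
  · exact ⟨⟨0, 1, 2, -1, by ring⟩, ⟨0, 0, 0, 1, by ring⟩, ⟨0, 1, 1, 0, by ring⟩,
      ⟨1, -1, -1, 1, by ring⟩⟩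
  · exact ⟨⟨0, -1, 1, -1, by ring⟩, ⟨-1, -1, 2, 0, by ring⟩, ⟨1, 1, -1, 0, by ring⟩,
      ⟨0, -1, 0, 0, by ring⟩⟩

lemma isHomogeneous_X_mul_X (i j : Fin 12) :
    (X i * X j : MvPolynomial (Fin 12) ℚ).IsHomogeneous 2 :=
  (isHomogeneous_X ..).mul (isHomogeneous_X ..)

lemma isHomogeneous_quadric (i j k l m n : Fin 12) :
    (X i * X j - X k * X l + X m * X n : MvPolynomial (Fin 12) ℚ).IsHomogeneous 2 :=
  ((isHomogeneous_X_mul_X ..).sub (isHomogeneous_X_mul_X ..)).add (isHomogeneous_X_mul_X ..)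

attribute [local instance] MvPolynomial.gradedAlgebra in
lemma isHomogeneous_godeauxQIdeal :
    godeauxQIdeal.IsHomogeneous (homogeneousSubmodule (Fin 12) ℚ) := by
  refine Ideal.homogeneous_span _ _ fun f hf => ⟨2, ?_⟩
  simp only [Set.mem_insert_iff, Set.mem_singleton_iff] at hf
  rcases hf with rfl | rfl | rfl | rfl <;> exact isHomogeneous_quadric ..

attribute [local instance] MvPolynomial.gradedAlgebra in
lemma godeauxQIdeal_weaklyRegular :
    IsWeaklyRegularMod godeauxQIdeal [X 11, X 10, X 9] := by
  let ls : List (MvPolynomial (Fin 12) ℚ) :=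
    [X 11, X 10, X 9, X 4 - X 5, X 0 - X 2, X 1 + X 2, X 7 - X 8 - X 6, X 3 - X 5]
  have hbot : (⊥ : Ideal (MvPolynomial (Fin 12) ℚ)).IsHomogeneous (homogeneousSubmodule _ _) :=
    Ideal.IsHomogeneous.bot _
  have hX (i : Fin 12) : (X i : MvPolynomial (Fin 12) ℚ).IsHomogeneous 1 := isHomogeneous_X ..
  have hXX := isHomogeneous_X_mul_X
  have hls : ∀ f ∈ ls, ∃ d, 0 < d ∧ f.IsHomogeneous d := by
    intro f hf
    refine ⟨1, one_pos, ?_⟩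
    revert f
    simp only [ls, List.forall_mem_cons, List.not_mem_nil, false_imp_iff, implies_true, and_true]
    exact ⟨hX _, hX _, hX _, (hX _).sub (hX _), (hX _).sub (hX _), (hX _).add (hX _),
      ((hX _).sub (hX _)).sub (hX _), (hX _).sub (hX _)⟩
  have h := triangular_weaklyRegular
  have h := h.perm hbot (List.perm_append_comm (l₁ := [_, _, _, _]) (l₂ := ls)) <| by
    refine List.forall_mem_append.2 ⟨fun f hf => ⟨2, two_pos, ?_⟩, hls⟩
    revert f
    simp only [List.forall_mem_cons, List.not_mem_nil, false_imp_iff, implies_true, and_true, sq]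
    exact ⟨hXX _ _, (hXX _ _).sub (hXX _ _), (hXX _ _).sub (hXX _ _), (hXX _ _).sub (hXX _ _)⟩
  have h := IsWeaklyRegularMod.append_iff.1 h
  rw [bot_sup_eq] at h
  have hmk : ∀ f ∈ ls, Ideal.Quotient.mk (Ideal.ofList ls) f = 0 := fun f hf =>
    Ideal.Quotient.eq_zero_iff_mem.2 (Ideal.subset_span hf)
  simp only [ls, List.forall_mem_cons, List.not_mem_nil, false_imp_iff, implies_true, and_true,
    map_sub, map_add] at hmk
  obtain ⟨h11, h10, h9, h4, h0, h1, h7, h3⟩ := hmk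
  have h := IsWeaklyRegularMod.append_iff.2 ⟨h.1, bot_sup_eq (Ideal.ofList ls) ▸ h.2.congr_mod (gs :=
    [X 10 * X 9 - X 2 * X 0 + X 5 * X 3 - (X 8 * X 6 - X 11 * X 9 + X 2 * X 1) -
        (X 11 * X 10 - X 8 * X 7 + X 5 * X 4),
      X 7 * X 6 - X 4 * X 3 + X 1 * X 0 + (X 10 * X 9 - X 2 * X 0 + X 5 * X 3) -
        2 * (X 8 * X 6 - X 11 * X 9 + X 2 * X 1),
      X 8 * X 6 - X 11 * X 9 + X 2 * X 1 - (X 7 * X 6 - X 4 * X 3 + X 1 * X 0) -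
        (X 10 * X 9 - X 2 * X 0 + X 5 * X 3),
      X 10 * X 9 - X 2 * X 0 + X 5 * X 3]) (by
    simp only [List.forall₂_cons, List.forall₂_nil_left_iff, and_true,
      ← Ideal.Quotient.mk_eq_mk_iff_sub_mem,
      map_sub, map_add, map_mul, map_pow, map_ofNat]
    rw [h11, h10, h9, sub_eq_zero.1 h4, sub_eq_zero.1 h0, eq_neg_of_add_eq_zero_left h1,
      sub_eq_zero.1 h3, sub_eq_zero.1 ((sub_sub _ _ _).symm.trans h7)]
    refine ⟨?_, ?_, ?_, ?_⟩ <;> ring)⟩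
  have h := h.perm hbot List.perm_append_comm <| by
    refine List.forall_mem_append.2 ⟨hls, fun f hf => ⟨2, two_pos, ?_⟩⟩
    have hq := isHomogeneous_quadric
    revert f
    simp only [List.forall_mem_cons, List.not_mem_nil, false_imp_iff, implies_true, and_true,
      two_mul]
    exact ⟨((hq ..).sub (hq ..)).sub (hq ..), ((hq ..).add (hq ..)).sub ((hq ..).add (hq ..)),
      ((hq ..).sub (hq ..)).sub (hq ..), hq ..⟩
  have h := (IsWeaklyRegularMod.append_iff.1 h).2
  rw [bot_sup_eq, ← godeauxQIdeal_eq_ofList] at h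
  exact (IsWeaklyRegularMod.append_iff (fs := [X 11, X 10, X 9]).1 h).1

lemma ofList_map_X_ne_top {l : List (Fin 12)} :
    (⊤ : Ideal godeauxSQ) ≠ Ideal.ofList (l.map abar) := by
  have hI : ∀ p ∈ godeauxQIdeal, constantCoeff p = 0 := fun p hp => by
    have : godeauxQIdeal ≤ RingHom.ker (constantCoeff (σ := Fin 12) (R := ℚ)) :=
      Ideal.span_le.2 (by simp [Set.insert_subset_iff, RingHom.mem_ker])
    exact this hp
  have hle : Ideal.ofList (l.map abar) ≤ RingHom.ker (Ideal.Quotient.lift godeauxQIdeal _ hI) :=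
    Ideal.span_le.2 fun x hx => by
      obtain ⟨i, -, rfl⟩ := List.mem_map.1 hx
      simp [abar]
  intro h
  exact RingHom.ker_ne_top _ (top_le_iff.1 (h.trans_le hle))

/-- A list of variables that an involutive symmetry of `godeauxQIdeal` carries to a permutation of
the first row of the `a`-matrix is regular. -/
lemma isRegular_of_symmetry {l : List (Fin 12)} {e : Fin 12 → Fin 12} (he : e.Involutive)
    (hI : godeauxQIdeal.map (rename (R := ℚ) e) ≤ godeauxQIdeal)
    (hl : ([11, 10, 9].map e).Perm l) :
    RingTheory.Sequence.IsRegular godeauxSQ (l.map abar) := by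
  have hsymm : (rename (R := ℚ) e).comp (rename e) = AlgHom.id ℚ _ := by
    ext i
    simp [he i]
  let E : MvPolynomial (Fin 12) ℚ ≃ₐ[ℚ] MvPolynomial (Fin 12) ℚ := .ofAlgHom _ _ hsymm hsymm
  have hE : godeauxQIdeal.map E.toRingEquiv = godeauxQIdeal := by
    refine le_antisymm hI fun p hp => ?_
    exact (Ideal.mem_map_of_equiv E.toRingEquiv p).2
      ⟨rename e p, hI (Ideal.mem_map_of_mem _ hp), DFunLike.congr_fun hsymm p⟩
  have h := godeauxQIdeal_weaklyRegular.map_equiv E.toRingEquiv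
  rw [hE] at h
  have h := h.perm isHomogeneous_godeauxQIdeal (gs := l.map X)
    (by simpa [E] using hl.map (X (R := ℚ)))
    (by simpa [E] using ⟨⟨1, one_pos, isHomogeneous_X ..⟩, ⟨1, one_pos, isHomogeneous_X ..⟩,
      ⟨1, one_pos, isHomogeneous_X ..⟩⟩)
  refine ⟨?_, ?_⟩
  · have := h.isWeaklyRegular_quotient
    rwa [List.map_map] at this
  · rw [smul_eq_mul, Ideal.mul_top]
    exact ofList_map_X_ne_top

/-- For each row of the `a`-matrix, the triple of its nonzero entries is a
regular sequence in `S_Q = ℚ[a^(k)_(i,j)]/(q0,q1,q2,q3)`. -/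
theorem godeaux_a_rows_regular :
    RingTheory.Sequence.IsRegular godeauxSQ [abar 11, abar 10, abar 9] ∧
    RingTheory.Sequence.IsRegular godeauxSQ [abar 8, abar 7, abar 6] ∧
    RingTheory.Sequence.IsRegular godeauxSQ [abar 5, abar 4, abar 3] ∧
    RingTheory.Sequence.IsRegular godeauxSQ [abar 2, abar 1, abar 0] := by
  have h0 : X 7 * X 6 - X 4 * X 3 + X 1 * X 0 ∈ godeauxQIdeal := Ideal.subset_span (by simp)
  have h1 : X 10 * X 9 - X 2 * X 0 + X 5 * X 3 ∈ godeauxQIdeal := Ideal.subset_span (by simp)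
  have h2 : X 8 * X 6 - X 11 * X 9 + X 2 * X 1 ∈ godeauxQIdeal := Ideal.subset_span (by simp)
  have h3 : X 11 * X 10 - X 8 * X 7 + X 5 * X 4 ∈ godeauxQIdeal := Ideal.subset_span (by simp)
  refine ⟨isRegular_of_symmetry (l := [11, 10, 9]) (e := id) (fun _ => rfl) ?_ (by decide),
    isRegular_of_symmetry (l := [8, 7, 6]) (e := ![3, 5, 4, 0, 2, 1, 10, 9, 11, 7, 6, 8])
      (fun i => by decide +revert) ?_ (by decide),
    isRegular_of_symmetry (l := [5, 4, 3]) (e := ![8, 6, 7, 11, 9, 10, 1, 2, 0, 4, 5, 3])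
      (fun i => by decide +revert) ?_ (by decide),
    isRegular_of_symmetry (l := [2, 1, 0]) (e := Fin.rev) Fin.rev_rev ?_ (by decide)⟩
  all_goals
    refine Ideal.map_le_iff_le_comap.2 (Ideal.span_le.2 ?_)
    simp only [Set.insert_subset_iff, Set.singleton_subset_iff, SetLike.mem_coe, Ideal.mem_comap,
      map_sub, map_add, map_mul, rename_X]
  · exact ⟨h0, h1, h2, h3⟩
  · refine ⟨?_, ?_, ?_, ?_⟩
    · convert h1 using 1; simp; ring
    · convert h0 using 1; simp; ring
    · convert h3 using 1; simp; ring
    · convert h2 using 1; simp; ring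
  · refine ⟨?_, ?_, ?_, ?_⟩
    · convert h2 using 1; simp; ring
    · convert h3 using 1; simp; ring
    · convert h0 using 1; simp; ring
    · convert h1 using 1; simp; ring
  · refine ⟨?_, ?_, ?_, ?_⟩
    · convert h3 using 1; simp; ring
    · convert h2 using 1; simp; ring
    · convert h1 using 1; simp; ring
    · convert h0 using 1; simp; ring
end

section
/- In the polynomial ring ℚ[a^(k)_(i,j)] in 12 variables, each of the following two explicit ideals is a prime ideal of height 6 containing the ideal (q0,q1,q2,q3): P₁ = (a^(0)_(0,3), a^(1)_(1,3), a^(2)_(2,3), a^(3)_(1,3), a^(3)_(2,3), a^(2)_(1,2)·a^(2)_(0,2) − a^(1)_(1,2)·a^(1)_(0,1) + a^(0)_(0,2)·a^(0)_(0,1)) and P₂ = (a^(0)_(0,3), a^(1)_(1,2), a^(2)_(2,3), a^(3)_(2,3), a^(2)_(1,2)·a^(2)_(0,2) + a^(0)_(0,2)·a^(0)_(0,1), a^(3)_(1,3)·a^(3)_(0,3) + a^(1)_(1,3)·a^(1)_(0,1)). (These are representatives of the two S₄-orbits of the 24 codimension-6 irreducible components of the support of the homology module H₁(C₂) inside Q.)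 -/
/-!
Two explicit ideals `P₁, P₂ ⊂ ℚ[a^(k)_(i,j)]` are prime of height 6 and
contain the ideal `(q0,q1,q2,q3)`. They represent the two `S₄`-orbits of the
24 codimension-6 irreducible components of the support of `H₁(C₂)` inside `Q`.

Variable indexing (`Fin 12`):
0 ↦ a^(3)_(2,3), 1 ↦ a^(3)_(1,3), 2 ↦ a^(3)_(0,3), 3 ↦ a^(2)_(2,3),
4 ↦ a^(2)_(1,2), 5 ↦ a^(2)_(0,2), 6 ↦ a^(1)_(1,3), 7 ↦ a^(1)_(1,2),
8 ↦ a^(1)_(0,1), 9 ↦ a^(0)_(0,3), 10 ↦ a^(0)_(0,2), 11 ↦ a^(0)_(0,1).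
-/

open MvPolynomial

/-- `P₁ = (a^(0)_(0,3), a^(1)_(1,3), a^(2)_(2,3), a^(3)_(1,3), a^(3)_(2,3),
a^(2)_(1,2)·a^(2)_(0,2) − a^(1)_(1,2)·a^(1)_(0,1) + a^(0)_(0,2)·a^(0)_(0,1))`. -/
noncomputable def godeauxP1 : Ideal (MvPolynomial (Fin 12) ℚ) :=
  Ideal.span {X 9, X 6, X 3, X 1, X 0, X 4 * X 5 - X 7 * X 8 + X 10 * X 11}

/-- `P₂ = (a^(0)_(0,3), a^(1)_(1,2), a^(2)_(2,3), a^(3)_(2,3),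
a^(2)_(1,2)·a^(2)_(0,2) + a^(0)_(0,2)·a^(0)_(0,1),
a^(3)_(1,3)·a^(3)_(0,3) + a^(1)_(1,3)·a^(1)_(0,1))`. -/
noncomputable def godeauxP2 : Ideal (MvPolynomial (Fin 12) ℚ) :=
  Ideal.span {X 9, X 7, X 3, X 0, X 4 * X 5 + X 10 * X 11, X 1 * X 2 + X 6 * X 8}

/-- Pseudo-division by a linear polynomial: up to a power of its leading coefficient, every
polynomial is congruent to a constant modulo `b X + c`. -/
lemma Polynomial.exists_linear_dvd_C_pow_mul_sub_C {A : Type*} [CommRing A] (b c : A)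
    (f : Polynomial A) :
    ∃ (n : ℕ) (r : A), C b * X + C c ∣ C b ^ n * f - C r := by
  induction f using Polynomial.induction_on' with
  | add f g hf hg =>
    obtain ⟨n, r, u, hu⟩ := hf
    obtain ⟨m, s, v, hv⟩ := hg
    refine ⟨n + m, b ^ m * r + b ^ n * s, C b ^ m * u + C b ^ n * v, ?_⟩
    simp only [map_add, map_mul, map_pow]
    linear_combination C b ^ m * hu + C b ^ n * hv
  | monomial k a =>
    induction k with
    | zero => exact ⟨0, a, 0, by simp⟩
    | succ k ih =>
      obtain ⟨n, r, u, hu⟩ := ih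
      refine ⟨n + 1, -(r * c), C b * X * u + C r, ?_⟩
      rw [← C_mul_X_pow_eq_monomial] at hu ⊢
      simp only [map_neg, map_mul]
      linear_combination C b * X * hu

/-- Over a domain, `b X + c` is prime as soon as `b` is prime and does not divide `c`. -/
lemma Polynomial.prime_C_mul_X_add_C {A : Type*} [CommRing A] [IsDomain A] {b c : A}
    (hb : Prime b) (hc : ¬ b ∣ c) : Prime (C b * X + C c : Polynomial A) := by
  have hdeg : (C b * X + C c : Polynomial A).natDegree = 1 := natDegree_linear hb.ne_zero
  have hp0 : (C b * X + C c : Polynomial A) ≠ 0 := by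
    intro h
    simp [h] at hdeg
  have hconst : ∀ r : A, C b * X + C c ∣ C r → r = 0 := by
    intro r hr
    by_contra hr0
    have := natDegree_le_of_dvd hr (by simpa using hr0)
    rw [hdeg, natDegree_C] at this
    omega
  have hCb : Prime (C b) := prime_C_iff.2 hb
  have hndvd : ¬ C b ∣ C b * X + C c := by
    rw [dvd_add_right (dvd_mul_right _ _)]
    intro h
    exact hc (by simpa using (C_dvd_iff_dvd_coeff _ _).1 h 0)
  have hcancel : ∀ (n : ℕ) (f : Polynomial A),
      C b * X + C c ∣ C b ^ n * f → C b * X + C c ∣ f := by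
    intro n
    induction n with
    | zero => simp
    | succ n ih =>
      rintro f ⟨h, hh⟩
      refine ih f ?_
      have hdvd : C b ∣ (C b * X + C c) * h := ⟨C b ^ n * f, by rw [← hh]; ring⟩
      obtain ⟨h', rfl⟩ := (hCb.dvd_or_dvd hdvd).resolve_left hndvd
      exact ⟨h', mul_left_cancel₀ hCb.ne_zero (by linear_combination hh)⟩
  refine ⟨hp0, fun hu ↦ ?_, fun f g hfg ↦ ?_⟩
  · have := natDegree_eq_zero_of_isUnit hu
    omega
  · obtain ⟨n, r, hr⟩ := exists_linear_dvd_C_pow_mul_sub_C b c f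
    obtain ⟨m, s, hs⟩ := exists_linear_dvd_C_pow_mul_sub_C b c g
    have hrs : C b * X + C c ∣ C (r * s) := by
      obtain ⟨u, hu⟩ := hr
      obtain ⟨v, hv⟩ := hs
      obtain ⟨w, hw⟩ := hfg
      refine ⟨C b ^ (n + m) * w - u * C b ^ m * g - C r * v, ?_⟩
      simp only [map_mul]
      linear_combination C b ^ (n + m) * hw - C b ^ m * g * hu - C r * hv
    rcases mul_eq_zero.1 (hconst _ hrs) with rfl | rfl
    · exact Or.inl (hcancel n f (by simpa using hr))
    · exact Or.inr (hcancel m g (by simpa using hs))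

/-- An ideal `(G)` is prime if `R → R ⧸ (G)` factors through a ring `S` in which some prime element
divides the images of all generators and is killed by `S → R ⧸ (G)`. -/
lemma Ideal.isPrime_of_comp_eq_mk {R S : Type*} [CommRing R] [CommRing S] {G : Set R}
    (ψ : R →+* S) (ρ : S →+* R ⧸ Ideal.span G) (hρψ : ρ.comp ψ = Ideal.Quotient.mk (Ideal.span G))
    {q : S} (hq : Prime q) (hG : ∀ g ∈ G, q ∣ ψ g) (hρq : ρ q = 0) : (Ideal.span G).IsPrime := by
  have hcomap : Ideal.span G = (Ideal.span {q}).comap ψ := by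
    refine le_antisymm
      (Ideal.span_le.2 fun g hg ↦ Ideal.mem_span_singleton.2 (hG g hg)) fun f hf ↦ ?_
    obtain ⟨g, hg⟩ := Ideal.mem_span_singleton.1 (Ideal.mem_comap.1 hf)
    refine Ideal.Quotient.eq_zero_iff_mem.1 ?_
    rw [← hρψ, RingHom.comp_apply, hg, map_mul, hρq, zero_mul]
  rw [hcomap]
  have := (Ideal.span_singleton_prime hq.ne_zero).2 hq
  exact Ideal.comap_isPrime ψ _

namespace MvPolynomial

variable {σ k : Type*}

lemma isPrime_span_X_image [CommRing k] [IsDomain k] (s : Set σ) :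
    (Ideal.span (X '' s : Set (MvPolynomial σ k))).IsPrime := by
  classical
  let φ : MvPolynomial σ k →ₐ[k] MvPolynomial σ k := aeval fun i ↦ if i ∈ s then 0 else X i
  have hφ : (Ideal.Quotient.mkₐ k (Ideal.span (X '' s))).comp φ =
      Ideal.Quotient.mkₐ k (Ideal.span (X '' s)) := by
    ext i
    by_cases hi : i ∈ s
    · have : (X i : MvPolynomial σ k) ∈ Ideal.span (X '' s) :=
        Ideal.subset_span (Set.mem_image_of_mem _ hi)
      simpa [φ, hi] using (Ideal.Quotient.eq_zero_iff_mem.2 this).symm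
    · simp [φ, hi]
  have hker : RingHom.ker φ = Ideal.span (X '' s) := by
    refine le_antisymm (fun f hf ↦ ?_) (Ideal.span_le.2 ?_)
    · have := DFunLike.congr_fun hφ f
      rw [AlgHom.comp_apply, RingHom.mem_ker.1 hf, map_zero] at this
      exact Ideal.Quotient.eq_zero_iff_mem.1 this.symm
    · rintro _ ⟨i, hi, rfl⟩
      simp [φ, hi]
  rw [← hker]
  exact RingHom.ker_isPrime φ

/-- If `G`, `b` and `c` do not involve the variable `X i`, then `(b X i + c, G)` is prime as soon as
its quotient map factors on the coefficients through a domain `A` in which `G` vanishes and `b` is a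
prime not dividing `c`. -/
lemma isPrime_span_insert_mul_X_add_of_comp_eq_mk [CommRing k] {A : Type*} [CommRing A]
    [IsDomain A] [Algebra k A] {G : Set (MvPolynomial σ k)} {i : σ} {b c : MvPolynomial σ k}
    (hG : G ⊆ supported k {i}ᶜ) (hb : b ∈ supported k {i}ᶜ) (hc : c ∈ supported k {i}ᶜ)
    (π : MvPolynomial σ k →ₐ[k] A)
    (ρ : A →+* MvPolynomial σ k ⧸ Ideal.span (insert (b * X i + c) G))
    (hρπ : ∀ f, ρ (π f) = Ideal.Quotient.mk _ f) (hπG : ∀ g ∈ G, π g = 0)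
    (hπb : Prime (π b)) (hbc : ¬ π b ∣ π c) :
    (Ideal.span (insert (b * X i + c) G)).IsPrime := by
  classical
  let ψ : MvPolynomial σ k →ₐ[k] Polynomial A :=
    aeval (Function.update (fun j ↦ Polynomial.C (π (X j))) i Polynomial.X)
  have hψ : ∀ f ∈ supported k {i}ᶜ, ψ f = Polynomial.C (π f) := by
    have : Set.EqOn ψ (Polynomial.CAlgHom.comp π) (supported k {i}ᶜ) := by
      refine AlgHom.eqOn_adjoin_iff.2 ?_
      rintro _ ⟨j, hj, rfl⟩
      simp only [Set.mem_compl_iff, Set.mem_singleton_iff] at hj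
      simp [ψ, Function.update_of_ne hj]
    exact fun f hf ↦ this hf
  let ρ' := Polynomial.eval₂RingHom ρ (Ideal.Quotient.mk _ (X i))
  have hρψ : ρ'.comp (ψ : MvPolynomial σ k →+* _) = Ideal.Quotient.mk _ := by
    refine ringHom_ext (fun r ↦ ?_) (fun j ↦ ?_)
    · have : ψ (C r) = Polynomial.C (π (C r)) := hψ _ (Subalgebra.algebraMap_mem _ r)
      simp only [RingHom.comp_apply, RingHom.coe_coe, this, ρ', Polynomial.coe_eval₂RingHom,
        Polynomial.eval₂_C, hρπ]
    · by_cases hj : j = i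
      · subst hj
        simp [ψ, ρ']
      · simp [ψ, ρ', Function.update_of_ne hj, hρπ]
  have hψq : ψ (b * X i + c) =
      Polynomial.C (π b) * Polynomial.X + Polynomial.C (π c) := by
    rw [map_add, map_mul, hψ b hb, hψ c hc]
    simp [ψ]
  have hq : Prime (ψ (b * X i + c)) := hψq ▸ Polynomial.prime_C_mul_X_add_C hπb hbc
  refine Ideal.isPrime_of_comp_eq_mk (ψ : MvPolynomial σ k →+* _) ρ' hρψ hq ?_ ?_
  · rintro g (rfl | hg)
    · exact dvd_rfl
    · have : ψ g = 0 := by rw [hψ g (hG hg), hπG g hg, map_zero]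
      exact this ▸ dvd_zero _
  · exact (DFunLike.congr_fun hρψ (b * X i + c)).trans
      (Ideal.Quotient.eq_zero_iff_mem.2 (Ideal.subset_span (Set.mem_insert _ _)))

/-- If `G`, `b` and `c` do not involve the variable `X i`, then adding `b X i + c` to the prime
ideal `(G)` gives a prime ideal as soon as `(b, G)` is a prime different from `(G)` which does
not contain `c`. -/
lemma isPrime_span_insert_mul_X_add [CommRing k] {G : Set (MvPolynomial σ k)} {i : σ}
    {b c : MvPolynomial σ k} (hG : G ⊆ supported k {i}ᶜ) (hb : b ∈ supported k {i}ᶜ)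
    (hc : c ∈ supported k {i}ᶜ) (hGp : (Ideal.span G).IsPrime)
    (hbp : (Ideal.span (insert b G)).IsPrime) (hb0 : b ∉ Ideal.span G)
    (hcb : c ∉ Ideal.span (insert b G)) :
    (Ideal.span (insert (b * X i + c) G)).IsPrime := by
  have hIJ : Ideal.span G ≤ Ideal.span (insert (b * X i + c) G) :=
    Ideal.span_mono (Set.subset_insert _ _)
  have hπ : ∀ f, Ideal.Quotient.mk (Ideal.span G) f = 0 ↔ f ∈ Ideal.span G :=
    fun f ↦ Ideal.Quotient.eq_zero_iff_mem
  have hdvd : ∀ f, Ideal.Quotient.mk (Ideal.span G) b ∣ Ideal.Quotient.mk (Ideal.span G) f ↔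
      f ∈ Ideal.span (insert b G) := by
    intro f
    rw [Ideal.mem_span_insert]
    constructor
    · rintro ⟨g, hg⟩
      obtain ⟨g, rfl⟩ := Ideal.Quotient.mk_surjective g
      refine ⟨g, f - g * b, (hπ _).1 ?_, by ring⟩
      rw [map_sub, hg, map_mul, mul_comm, sub_self]
    · rintro ⟨g, z, hz, rfl⟩
      exact ⟨Ideal.Quotient.mk _ g, by rw [map_add, (hπ z).2 hz, map_mul, add_zero, mul_comm]⟩
  refine isPrime_span_insert_mul_X_add_of_comp_eq_mk hG hb hc
    (Ideal.Quotient.mkₐ k (Ideal.span G)) (Ideal.Quotient.factor hIJ)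
    (Ideal.Quotient.factor_mk hIJ) (fun g hg ↦ (hπ g).2 (Ideal.subset_span hg))
    ⟨fun h ↦ hb0 ((hπ b).1 h), fun h ↦ ?_, fun f g h ↦ ?_⟩ fun h ↦ hcb ((hdvd c).1 h)
  · exact hbp.ne_top ((Ideal.eq_top_iff_one _).2 ((hdvd 1).1 h.dvd))
  · obtain ⟨f, rfl⟩ := Ideal.Quotient.mk_surjective f
    obtain ⟨g, rfl⟩ := Ideal.Quotient.mk_surjective g
    have := (hdvd (f * g)).1 (by rw [map_mul]; exact h)
    exact (hbp.mem_or_mem this).imp (hdvd f).2 (hdvd g).2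

/-- A polynomial not vanishing at a common zero of `G` is not in the ideal generated by `G`. -/
lemma notMem_span_of_eval_ne_zero [CommRing k] {G : Set (MvPolynomial σ k)}
    {f : MvPolynomial σ k} (v : σ → k) (hG : ∀ g ∈ G, eval v g = 0) (hf : eval v f ≠ 0) :
    f ∉ Ideal.span G := fun h ↦
  hf (RingHom.mem_ker.1 ((Ideal.span_le (I := RingHom.ker (eval v))).2 hG h))

lemma card_le_height_span_X_image [CommRing k] [IsDomain k] (s : Finset σ) :
    (s.card : ℕ∞) ≤ (Ideal.span (X '' (s : Set σ) : Set (MvPolynomial σ k))).height := by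
  classical
  induction s using Finset.induction_on with
  | empty => simp
  | insert a s ha ih =>
    have := isPrime_span_X_image (k := k) (s : Set σ)
    have := isPrime_span_X_image (k := k) ((insert a s : Finset σ) : Set σ)
    have hlt : Ideal.span (X '' (s : Set σ) : Set (MvPolynomial σ k)) <
        Ideal.span (X '' ((insert a s : Finset σ) : Set σ)) := by
      refine SetLike.lt_iff_le_and_exists.2 ⟨Ideal.span_mono (Set.image_mono (by simp)), X a,
        Ideal.subset_span (Set.mem_image_of_mem _ (by simp)), ?_⟩
      refine notMem_span_of_eval_ne_zero (Pi.single a 1) ?_ (by simp)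
      rintro _ ⟨j, hj, rfl⟩
      have : j ≠ a := fun h ↦ ha (h ▸ hj)
      simp [this]
    rw [Finset.card_insert_of_notMem ha, Nat.cast_add, Nat.cast_one]
    exact (add_le_add_left ih 1).trans (Ideal.height_add_one_le_of_lt_of_isPrime hlt)

end MvPolynomial

lemma Ideal.height_span_add_one_le_height_span_insert {R : Type*} [CommRing R] {G : Set R} {f : R}
    (hG : (Ideal.span G).IsPrime) (hfG : (Ideal.span (insert f G)).IsPrime)
    (hf : f ∉ Ideal.span G) :
    (Ideal.span G).height + 1 ≤ (Ideal.span (insert f G)).height :=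
  Ideal.height_add_one_le_of_lt_of_isPrime (SetLike.lt_iff_le_and_exists.2
    ⟨Ideal.span_mono (Set.subset_insert _ _), f, Ideal.subset_span (Set.mem_insert _ _), hf⟩)

lemma Ideal.height_span_finset_le_card {R : Type*} [CommRing R] [IsNoetherianRing R]
    (s : Finset R) (hs : (Ideal.span (s : Set R)).IsPrime) :
    (Ideal.span (s : Set R)).height ≤ s.card :=
  Ideal.height_le_card_of_mem_minimalPrimes_span_finset
    (by rw [Ideal.minimalPrimes_eq_subsingleton_self]; rfl)

lemma idealHeight_eq_height {R : Type*} [CommRing R] {I : Ideal R} (hI : I.IsPrime) :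
    idealHeight I = I.height := by
  rw [PrimeSpectrum.height_eq_orderHeight ⟨I, hI⟩]
  refine le_antisymm (iInf₂_le (⟨I, hI⟩ : PrimeSpectrum R) le_rfl) (le_iInf₂ fun P hP ↦ ?_)
  exact Order.height_mono hP

lemma godeauxP1_isPrime_and_height : godeauxP1.IsPrime ∧ godeauxP1.height = 6 := by
  classical
  let s : Finset (Fin 12) := {9, 6, 3, 1, 0}
  let q : MvPolynomial (Fin 12) ℚ := X 4 * X 5 + (X 10 * X 11 - X 7 * X 8)
  have hP : godeauxP1 = Ideal.span (insert q (X '' (s : Set (Fin 12)))) := by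
    rw [godeauxP1]
    congr 1
    have : (X 4 * X 5 - X 7 * X 8 + X 10 * X 11 : MvPolynomial (Fin 12) ℚ) = q := by
      simp only [q]; ring
    rw [this]
    ext f
    simp only [s, Finset.coe_insert, Finset.coe_singleton, Set.image_insert_eq,
      Set.image_singleton, Set.mem_insert_iff, Set.mem_singleton_iff]
    tauto
  have hs : (Ideal.span (X '' (s : Set (Fin 12)) : Set (MvPolynomial (Fin 12) ℚ))).IsPrime :=
    isPrime_span_X_image _
  have hprime : (Ideal.span (insert q (X '' (s : Set (Fin 12))))).IsPrime := by
    refine isPrime_span_insert_mul_X_add ?_ ?_ ?_ hs ?_ ?_ ?_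
    · rintro _ ⟨j, hj, rfl⟩
      refine X_mem_supported.2 ?_
      rintro rfl
      simp [s] at hj
    · exact X_mem_supported.2 (by simp)
    · exact sub_mem (mul_mem (X_mem_supported.2 (by simp)) (X_mem_supported.2 (by simp)))
        (mul_mem (X_mem_supported.2 (by simp)) (X_mem_supported.2 (by simp)))
    · rw [← Set.image_insert_eq]
      exact isPrime_span_X_image _
    · exact notMem_span_of_eval_ne_zero (fun j ↦ if j = 4 then 1 else 0) (by simp [s, or_imp, forall_and]) (by simp)
    · exact notMem_span_of_eval_ne_zero (fun j ↦ if j = 10 ∨ j = 11 then 1 else 0) (by simp [s, or_imp, forall_and])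
        (by simp)
  have hq : q ∉ Ideal.span (X '' (s : Set (Fin 12))) :=
    notMem_span_of_eval_ne_zero (fun j ↦ if j = 10 ∨ j = 11 then 1 else 0) (by simp [s, or_imp, forall_and])
      (by simp [q])
  refine ⟨hP ▸ hprime, le_antisymm ?_ ?_⟩
  · have hfin : godeauxP1 = Ideal.span
        (({X 9, X 6, X 3, X 1, X 0, X 4 * X 5 - X 7 * X 8 + X 10 * X 11} :
          Finset (MvPolynomial (Fin 12) ℚ)) : Set (MvPolynomial (Fin 12) ℚ)) := by
      simp [godeauxP1]
    rw [hfin]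
    exact (Ideal.height_span_finset_le_card _ (hfin ▸ hP ▸ hprime)).trans
      (by exact_mod_cast Finset.card_le_six)
  · rw [hP]
    refine le_trans ?_ (Ideal.height_span_add_one_le_height_span_insert hs hprime hq)
    exact add_le_add_left (card_le_height_span_X_image s) 1

lemma godeauxP2_isPrime_and_height : godeauxP2.IsPrime ∧ godeauxP2.height = 6 := by
  classical
  let s : Finset (Fin 12) := {9, 7, 3, 0}
  let q : MvPolynomial (Fin 12) ℚ := X 4 * X 5 + X 10 * X 11
  let r : MvPolynomial (Fin 12) ℚ := X 2 * X 1 + X 6 * X 8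
  have hP : godeauxP2 = Ideal.span (insert r (insert q (X '' (s : Set (Fin 12))))) := by
    rw [godeauxP2]
    congr 1
    have : (X 1 * X 2 + X 6 * X 8 : MvPolynomial (Fin 12) ℚ) = r := by
      simp only [r]; ring
    rw [this]
    ext f
    simp only [s, q, Finset.coe_insert, Finset.coe_singleton, Set.image_insert_eq,
      Set.image_singleton, Set.mem_insert_iff, Set.mem_singleton_iff]
    tauto
  have hprime_q : ∀ t : Set (Fin 12), 4 ∉ t → 5 ∉ t → 10 ∉ t → 11 ∉ t →
      (Ideal.span (insert q (X '' t))).IsPrime := by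
    intro t h4 h5 h10 h11
    refine isPrime_span_insert_mul_X_add ?_ ?_ ?_ (isPrime_span_X_image _) ?_ ?_ ?_
    · rintro _ ⟨j, hj, rfl⟩
      refine X_mem_supported.2 ?_
      rintro rfl
      exact h5 hj
    · exact X_mem_supported.2 (by simp)
    · exact mul_mem (X_mem_supported.2 (by simp)) (X_mem_supported.2 (by simp))
    · rw [← Set.image_insert_eq]
      exact isPrime_span_X_image _
    · refine notMem_span_of_eval_ne_zero (fun j ↦ if j = 4 then 1 else 0) ?_ (by simp)
      rintro _ ⟨j, hj, rfl⟩
      have : j ≠ 4 := fun h ↦ h4 (h ▸ hj)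
      simp [this]
    · refine notMem_span_of_eval_ne_zero (fun j ↦ if j = 10 ∨ j = 11 then 1 else 0) ?_ (by simp)
      rintro _ (rfl | ⟨j, hj, rfl⟩)
      · simp
      · have : j ≠ 10 := fun h ↦ h10 (h ▸ hj)
        have : j ≠ 11 := fun h ↦ h11 (h ▸ hj)
        simp [*]
  have hs : (Ideal.span (X '' (s : Set (Fin 12)) : Set (MvPolynomial (Fin 12) ℚ))).IsPrime :=
    isPrime_span_X_image _
  have hsq : (Ideal.span (insert q (X '' (s : Set (Fin 12))))).IsPrime :=
    hprime_q _ (by simp [s]) (by simp [s]) (by simp [s]) (by simp [s])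
  have hprime : (Ideal.span (insert r (insert q (X '' (s : Set (Fin 12)))))).IsPrime := by
    refine isPrime_span_insert_mul_X_add ?_ ?_ ?_ hsq ?_ ?_ ?_
    · rintro _ (rfl | ⟨j, hj, rfl⟩)
      · exact add_mem (mul_mem (X_mem_supported.2 (by simp)) (X_mem_supported.2 (by simp)))
          (mul_mem (X_mem_supported.2 (by simp)) (X_mem_supported.2 (by simp)))
      · refine X_mem_supported.2 ?_
        rintro rfl
        simp [s] at hj
    · exact X_mem_supported.2 (by simp)
    · exact mul_mem (X_mem_supported.2 (by simp)) (X_mem_supported.2 (by simp))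
    · rw [Set.insert_comm, ← Set.image_insert_eq]
      exact hprime_q _ (by simp [s]) (by simp [s]) (by simp [s]) (by simp [s])
    · exact notMem_span_of_eval_ne_zero (fun j ↦ if j = 2 then 1 else 0) (by simp [s, q, or_imp, forall_and])
        (by simp)
    · exact notMem_span_of_eval_ne_zero (fun j ↦ if j = 6 ∨ j = 8 then 1 else 0)
        (by simp [s, q, or_imp, forall_and]) (by simp)
  have hq : q ∉ Ideal.span (X '' (s : Set (Fin 12))) :=
    notMem_span_of_eval_ne_zero (fun j ↦ if j = 10 ∨ j = 11 then 1 else 0) (by simp [s, or_imp, forall_and])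
      (by simp [q])
  have hr : r ∉ Ideal.span (insert q (X '' (s : Set (Fin 12)))) :=
    notMem_span_of_eval_ne_zero (fun j ↦ if j = 6 ∨ j = 8 then 1 else 0) (by simp [s, q, or_imp, forall_and])
      (by simp [r])
  refine ⟨hP ▸ hprime, le_antisymm ?_ ?_⟩
  · have hfin : godeauxP2 = Ideal.span
        (({X 9, X 7, X 3, X 0, X 4 * X 5 + X 10 * X 11, X 1 * X 2 + X 6 * X 8} :
          Finset (MvPolynomial (Fin 12) ℚ)) : Set (MvPolynomial (Fin 12) ℚ)) := by
      simp [godeauxP2]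
    rw [hfin]
    exact (Ideal.height_span_finset_le_card _ (hfin ▸ hP ▸ hprime)).trans
      (by exact_mod_cast Finset.card_le_six)
  · rw [hP]
    refine le_trans ?_ (Ideal.height_span_add_one_le_height_span_insert hsq hprime hr)
    refine le_trans ?_ (add_le_add_left
      (Ideal.height_span_add_one_le_height_span_insert hs hsq hq) 1)
    exact add_le_add_left (add_le_add_left (card_le_height_span_X_image s) 1) 1

lemma godeauxQIdeal_le_godeauxP1 : godeauxQIdeal ≤ godeauxP1 := by
  have h : ∀ f ∈ ({X 9, X 6, X 3, X 1, X 0, X 4 * X 5 - X 7 * X 8 + X 10 * X 11} :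
      Set (MvPolynomial (Fin 12) ℚ)), Ideal.Quotient.mk godeauxP1 f = 0 :=
    fun f hf ↦ Ideal.Quotient.eq_zero_iff_mem.2 (Ideal.subset_span hf)
  simp only [Set.mem_insert_iff, Set.mem_singleton_iff, forall_eq_or_imp, forall_eq, map_add,
    map_sub, map_mul] at h
  obtain ⟨h9, h6, h3, h1, h0, hq⟩ := h
  refine Ideal.span_le.2 ?_
  rintro f (rfl | rfl | rfl | rfl) <;> refine Ideal.Quotient.eq_zero_iff_mem.1 ?_ <;>
    simp only [map_add, map_sub, map_mul, h9, h6, h3, h1, h0, mul_zero, sub_zero, add_zero]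
  linear_combination hq

lemma godeauxQIdeal_le_godeauxP2 : godeauxQIdeal ≤ godeauxP2 := by
  have h : ∀ f ∈ ({X 9, X 7, X 3, X 0, X 4 * X 5 + X 10 * X 11, X 1 * X 2 + X 6 * X 8} :
      Set (MvPolynomial (Fin 12) ℚ)), Ideal.Quotient.mk godeauxP2 f = 0 :=
    fun f hf ↦ Ideal.Quotient.eq_zero_iff_mem.2 (Ideal.subset_span hf)
  simp only [Set.mem_insert_iff, Set.mem_singleton_iff, forall_eq_or_imp, forall_eq, map_add,
    map_mul] at h
  obtain ⟨h9, h7, h3, h0, hq, hr⟩ := h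
  refine Ideal.span_le.2 ?_
  rintro f (rfl | rfl | rfl | rfl) <;> refine Ideal.Quotient.eq_zero_iff_mem.1 ?_ <;>
    simp only [map_add, map_sub, map_mul, h9, h7, h3, h0, mul_zero, zero_mul, sub_zero, add_zero]
  · linear_combination hr
  · linear_combination hq

/-- `P₁` and `P₂` are prime ideals of height 6 containing `(q0,q1,q2,q3)`. -/
theorem godeaux_H1C2_components :
    (godeauxP1.IsPrime ∧ idealHeight godeauxP1 = 6 ∧ godeauxQIdeal ≤ godeauxP1) ∧
    (godeauxP2.IsPrime ∧ idealHeight godeauxP2 = 6 ∧ godeauxQIdeal ≤ godeauxP2) := by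
  obtain ⟨hp₁, hh₁⟩ := godeauxP1_isPrime_and_height
  obtain ⟨hp₂, hh₂⟩ := godeauxP2_isPrime_and_height
  exact ⟨⟨hp₁, (idealHeight_eq_height hp₁).trans hh₁, godeauxQIdeal_le_godeauxP1⟩,
    ⟨hp₂, (idealHeight_eq_height hp₂).trans hh₂, godeauxQIdeal_le_godeauxP2⟩⟩
end

section
/- In the polynomial ring ℚ[v0, v1, w0, w1, x0, x1, y0, y1, z0, z1], substitute for the 12 coordinates, in the order (a^(3)_(2,3), a^(3)_(1,3), a^(3)_(0,3), a^(2)_(2,3), a^(2)_(1,2), a^(2)_(0,2), a^(1)_(1,3), a^(1)_(1,2), a^(1)_(0,1), a^(0)_(0,3), a^(0)_(0,2), a^(0)_(0,1)), the 12 polynomials P₁ = v0²(x1w1−x0w0)x1(x1+x0)y0y1z1², P₂ = v0²(x1w1−x0w0)x0(x1+x0)y0y1z0², P₃ = −v1²w0²w1²(w1+w0)x0x1(x1+x0)y0y1z1², P₄ = −v0²(x1w1−x0w0)x0x1y0²z1², P₅ = −v0²(x1w1−x0w0)x0(x1+x0)y1²z0², P₆ = v1²w0²w1(w1+w0)²x0x1(x1+x0)y1²z1²,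 P₇ = −v0²(x1w1−x0w0)x0x1y0²z0z1, P₈ = v0²(x1w1−x0w0)x1(x1+x0)y1²z0z1, P₉ = −v1²w0w1²(w1+w0)²x0x1(x1+x0)y1²z0z1, P₁₀ = −v0v1w0w1(x1w1−x0w0)x0x1y0²z1², P₁₁ = v0v1w0(w1+w0)(x1w1−x0w0)x1(x1+x0)y1²z1², P₁₂ = −v0v1w1(w1+w0)(x1w1−x0w0)x0(x1+x0)y1²z0². Then each of the four quadrics q0, q1, q2, q3 evaluates to the zero polynomial. Hence the image of the parametrization φ of the hyperelliptic locus V_hyp is contained in the complete intersection Q ⊂ ℙ¹¹. -/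
/-!
The parametrization of the hyperelliptic locus `V_hyp`: substituting the 12
polynomials `P₁,…,P₁₂` (in the variables `v0,v1,w0,w1,x0,x1,y0,y1,z0,z1`) for
the 12 coordinates `a^(k)_(i,j)` makes each of the four quadrics
`q0, q1, q2, q3` vanish identically; hence the image of the parametrization
`φ` of `V_hyp` is contained in `Q ⊂ ℙ¹¹`.

Coordinate order (`Fin 12`):
0 ↦ a^(3)_(2,3), 1 ↦ a^(3)_(1,3), 2 ↦ a^(3)_(0,3), 3 ↦ a^(2)_(2,3),
4 ↦ a^(2)_(1,2), 5 ↦ a^(2)_(0,2), 6 ↦ a^(1)_(1,3), 7 ↦ a^(1)_(1,2),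
8 ↦ a^(1)_(0,1), 9 ↦ a^(0)_(0,3), 10 ↦ a^(0)_(0,2), 11 ↦ a^(0)_(0,1).

Parameter variables (`Fin 10`):
0 ↦ v0, 1 ↦ v1, 2 ↦ w0, 3 ↦ w1, 4 ↦ x0, 5 ↦ x1, 6 ↦ y0, 7 ↦ y1, 8 ↦ z0, 9 ↦ z1.
-/

open MvPolynomial

set_option maxHeartbeats 1000000

noncomputable def hP1 : MvPolynomial (Fin 10) ℚ :=
  X 0 ^ 2 * (X 5 * X 3 - X 4 * X 2) * X 5 * (X 5 + X 4) * X 6 * X 7 * X 9 ^ 2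

noncomputable def hP2 : MvPolynomial (Fin 10) ℚ :=
  X 0 ^ 2 * (X 5 * X 3 - X 4 * X 2) * X 4 * (X 5 + X 4) * X 6 * X 7 * X 8 ^ 2

noncomputable def hP3 : MvPolynomial (Fin 10) ℚ :=
  -(X 1 ^ 2 * X 2 ^ 2 * X 3 ^ 2 * (X 3 + X 2) * X 4 * X 5 * (X 5 + X 4) * X 6 * X 7 * X 9 ^ 2)

noncomputable def hP4 : MvPolynomial (Fin 10) ℚ :=
  -(X 0 ^ 2 * (X 5 * X 3 - X 4 * X 2) * X 4 * X 5 * X 6 ^ 2 * X 9 ^ 2)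

noncomputable def hP5 : MvPolynomial (Fin 10) ℚ :=
  -(X 0 ^ 2 * (X 5 * X 3 - X 4 * X 2) * X 4 * (X 5 + X 4) * X 7 ^ 2 * X 8 ^ 2)

noncomputable def hP6 : MvPolynomial (Fin 10) ℚ :=
  X 1 ^ 2 * X 2 ^ 2 * X 3 * (X 3 + X 2) ^ 2 * X 4 * X 5 * (X 5 + X 4) * X 7 ^ 2 * X 9 ^ 2

noncomputable def hP7 : MvPolynomial (Fin 10) ℚ :=
  -(X 0 ^ 2 * (X 5 * X 3 - X 4 * X 2) * X 4 * X 5 * X 6 ^ 2 * X 8 * X 9)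

noncomputable def hP8 : MvPolynomial (Fin 10) ℚ :=
  X 0 ^ 2 * (X 5 * X 3 - X 4 * X 2) * X 5 * (X 5 + X 4) * X 7 ^ 2 * X 8 * X 9

noncomputable def hP9 : MvPolynomial (Fin 10) ℚ :=
  -(X 1 ^ 2 * X 2 * X 3 ^ 2 * (X 3 + X 2) ^ 2 * X 4 * X 5 * (X 5 + X 4) * X 7 ^ 2 * X 8 * X 9)

noncomputable def hP10 : MvPolynomial (Fin 10) ℚ :=
  -(X 0 * X 1 * X 2 * X 3 * (X 5 * X 3 - X 4 * X 2) * X 4 * X 5 * X 6 ^ 2 * X 9 ^ 2)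

noncomputable def hP11 : MvPolynomial (Fin 10) ℚ :=
  X 0 * X 1 * X 2 * (X 3 + X 2) * (X 5 * X 3 - X 4 * X 2) * X 5 * (X 5 + X 4) * X 7 ^ 2 * X 9 ^ 2

noncomputable def hP12 : MvPolynomial (Fin 10) ℚ :=
  -(X 0 * X 1 * X 3 * (X 3 + X 2) * (X 5 * X 3 - X 4 * X 2) * X 4 * (X 5 + X 4) * X 7 ^ 2 * X 8 ^ 2)

/-- The 12 polynomials `P₁,…,P₁₂` of the hyperelliptic-locus parametrization,
indexed by the corresponding coordinate of `ℙ¹¹`. -/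
noncomputable def hypParam : Fin 12 → MvPolynomial (Fin 10) ℚ :=
  ![hP1, hP2, hP3, hP4, hP5, hP6, hP7, hP8, hP9, hP10, hP11, hP12]

/-- Substituting the hyperelliptic-locus parametrization into each quadric
`q_i` yields the zero polynomial. -/
theorem hyperelliptic_locus_in_Q (i : Fin 4) :
    MvPolynomial.aeval hypParam (godeauxQ i) = 0 := by
  fin_cases i <;>
    simp [godeauxQ, hypParam] <;>
    simp only [hP1, hP2, hP3, hP4, hP5, hP6, hP7, hP8, hP9, hP10, hP11, hP12] <;>
    ring
end

section
/- Let a(P) be the 4×6 matrix over the polynomial ring ℚ[v0, v1, w0, w1, x0, x1, y0, y1, z0, z1] obtained from the a-matrix by substituting the hyperelliptic-locus parametrization: its rows are (P₁₂, P₁₁, 0, P₁₀, 0, 0), (P₉, 0, P₈, 0, P₇, 0), (0, P₆, P₅, 0, 0, P₄), (0, 0, 0, P₃, P₂, P₁). Then every 4×4 minor of a(P) is the zero polynomial; i.e., at every point of the hyperelliptic locus V_hyp the a-matrix has rank at most 3 (corresponding to the characterization that a bicanonical fiber C_q is hyperelliptic if and only if rank a(q) = 3). -/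
/-!
On the hyperelliptic locus the `a`-matrix has rank at most 3: substituting the
parametrization `P₁,…,P₁₂` of `V_hyp` into the `4×6` `a`-matrix, every `4×4`
minor of the resulting matrix `a(P)` is the zero polynomial.

Parameter variables (`Fin 10`):
0 ↦ v0, 1 ↦ v1, 2 ↦ w0, 3 ↦ w1, 4 ↦ x0, 5 ↦ x1, 6 ↦ y0, 7 ↦ y1, 8 ↦ z0, 9 ↦ z1.
-/

open MvPolynomial

set_option maxHeartbeats 1000000

/-- The `4×6` `a`-matrix with the hyperelliptic-locus parametrization
substituted for the 12 variables `a^(k)_(i,j)`. -/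
noncomputable def aMatrixHyp : Matrix (Fin 4) (Fin 6) (MvPolynomial (Fin 10) ℚ) :=
  !![hP12, hP11, 0, hP10, 0, 0;
     hP9, 0, hP8, 0, hP7, 0;
     0, hP6, hP5, 0, 0, hP4;
     0, 0, 0, hP3, hP2, hP1]

/-- A nonzero vector annihilating the rows of `aMatrixHyp` from the left. -/
noncomputable def aMatrixHypLeftKernel : Fin 4 → MvPolynomial (Fin 10) ℚ :=
  ![-(X 1 * X 2 * X 3 * (X 3 + X 2) * (X 5 + X 4) * X 7 * X 4 * X 5 * X 9),
    X 0 * (X 5 * X 3 - X 4 * X 2) * (X 5 + X 4) * X 7 * X 8 * X 4,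
    X 0 * (X 5 * X 3 - X 4 * X 2) * (X 5 + X 4) * X 7 * X 5 * X 9,
    X 0 * (X 5 * X 3 - X 4 * X 2) * X 6 * X 4 * X 5 * X 9]

lemma aMatrixHypLeftKernel_ne_zero : aMatrixHypLeftKernel ≠ 0 := by
  intro h
  have h0 := congrArg (eval fun _ => (1 : ℚ)) (congrFun h 0)
  norm_num [aMatrixHypLeftKernel] at h0

lemma aMatrixHypLeftKernel_vecMul : Matrix.vecMul aMatrixHypLeftKernel aMatrixHyp = 0 := by
  ext1 j
  fin_cases j <;>
    simp [Matrix.vecMul, dotProduct, Fin.sum_univ_four, aMatrixHypLeftKernel, aMatrixHyp] <;>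
    simp only [hP1, hP2, hP3, hP4, hP5, hP6, hP7, hP8, hP9, hP10, hP11, hP12] <;>
    ring

/-- Every `4×4` minor of the substituted `a`-matrix vanishes: at every point of
the hyperelliptic locus `V_hyp` the `a`-matrix has rank at most 3. -/
theorem aMatrix_rank_le_three_on_hyp_locus
    (c : Fin 4 → Fin 6) (hc : Function.Injective c) :
    (aMatrixHyp.submatrix id c).det = 0 := by
  refine Matrix.exists_vecMul_eq_zero_iff.mp
    ⟨aMatrixHypLeftKernel, aMatrixHypLeftKernel_ne_zero, ?_⟩
  ext1 j
  exact congrFun aMatrixHypLeftKernel_vecMul (c j)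
end

section
/- Let K be a commutative ring, ζ ∈ K with ζ⁵ = 1, and a1,…,a6 ∈ K. Let A be the symmetric 5×5 matrix over K[u1,u2,u3,u4] with rows (0, a1u1, a2u2, a2u3, a1u4), (a1u1, a3u2, a4u3, a5u4, 0), (a2u2, a4u3, a6u4, 0, a5u1), (a2u3, a5u4, 0, a6u1, a4u2), (a1u4, 0, a5u1, a4u2, a3u3). Then the quintic det A is invariant under the dihedral D₅-action on ℙ³: (i) det A is unchanged under the substitution u1 ↦ ζu1, u2 ↦ ζ²u2, u3 ↦ ζ³u3, u4 ↦ ζ⁴u4, and (ii) det A is unchanged under the substitution (u1, u2, u3, u4) ↦ (u4, u3, u2, u1). -/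
/-!
The symmetric determinantal quintic of Barlow's construction is invariant
under the dihedral `D₅`-action on `ℙ³`: `det A` is unchanged both under
`β : u_j ↦ ζ^j·u_j` (with `ζ⁵ = 1`) and under
`τ : (u1,u2,u3,u4) ↦ (u4,u3,u2,u1)`.

Variables (`Fin 4`): 0 ↦ u1, 1 ↦ u2, 2 ↦ u3, 3 ↦ u4.
-/

open MvPolynomial

/-- The symmetric `5×5` matrix `A` of Barlow's construction. -/
noncomputable def barlowMatrix {K : Type*} [CommRing K] (a1 a2 a3 a4 a5 a6 : K) :
    Matrix (Fin 5) (Fin 5) (MvPolynomial (Fin 4) K) :=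
  !![0, C a1 * X 0, C a2 * X 1, C a2 * X 2, C a1 * X 3;
     C a1 * X 0, C a3 * X 1, C a4 * X 2, C a5 * X 3, 0;
     C a2 * X 1, C a4 * X 2, C a6 * X 3, 0, C a5 * X 0;
     C a2 * X 2, C a5 * X 3, 0, C a6 * X 0, C a4 * X 1;
     C a1 * X 3, 0, C a5 * X 0, C a4 * X 1, C a3 * X 2]

/-- Substituting `u_j ↦ ζ^j·u_j` scales the `(i, j)` entry of `A` by `ζ^(i+j)`. -/
lemma map_scale_barlowMatrix {K : Type*} [CommRing K] (ζ : K) (hζ : ζ ^ 5 = 1)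
    (a1 a2 a3 a4 a5 a6 : K) :
    (aeval (fun i : Fin 4 => (C (ζ ^ ((i : ℕ) + 1)) * X i : MvPolynomial (Fin 4) K))).mapMatrix
        (barlowMatrix a1 a2 a3 a4 a5 a6) =
      Matrix.diagonal (fun i : Fin 5 => (C ζ ^ (i : ℕ) : MvPolynomial (Fin 4) K)) *
        barlowMatrix a1 a2 a3 a4 a5 a6 *
          Matrix.diagonal (fun i : Fin 5 => (C ζ ^ (i : ℕ) : MvPolynomial (Fin 4) K)) := by
  have h : (C ζ : MvPolynomial (Fin 4) K) ^ 5 = 1 := by rw [← C_pow, hζ, C_1]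
  ext1 i j
  rw [Matrix.mul_diagonal, Matrix.diagonal_mul]
  fin_cases i <;> fin_cases j <;>
    simp [barlowMatrix, algebraMap_eq] <;> grind

/-- Reversing the variables permutes the rows and columns of `A` by `i ↦ -i` modulo `5`. -/
lemma map_rev_barlowMatrix {K : Type*} [CommRing K] (a1 a2 a3 a4 a5 a6 : K) :
    (aeval (fun i : Fin 4 => (X i.rev : MvPolynomial (Fin 4) K))).mapMatrix
        (barlowMatrix a1 a2 a3 a4 a5 a6) =
      (barlowMatrix a1 a2 a3 a4 a5 a6).submatrix (Equiv.neg (Fin 5)) (Equiv.neg (Fin 5)) := by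
  have h1 : -(1 : Fin 5) = 4 := rfl
  have h2 : -(2 : Fin 5) = 3 := rfl
  have h3 : -(3 : Fin 5) = 2 := rfl
  have h4 : -(4 : Fin 5) = 1 := rfl
  have r0 : Fin.rev (0 : Fin 4) = 3 := rfl
  have r1 : Fin.rev (1 : Fin 4) = 2 := rfl
  have r2 : Fin.rev (2 : Fin 4) = 1 := rfl
  have r3 : Fin.rev (3 : Fin 4) = 0 := rfl
  ext1 i j
  fin_cases i <;> fin_cases j <;>
    simp [barlowMatrix, algebraMap_eq, h1, h2, h3, h4, r0, r1, r2, r3]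

/-- `det A` is invariant under the `D₅`-action: (i) under the substitution
`u1 ↦ ζu1, u2 ↦ ζ²u2, u3 ↦ ζ³u3, u4 ↦ ζ⁴u4`, and (ii) under
`(u1,u2,u3,u4) ↦ (u4,u3,u2,u1)`. -/
theorem barlow_quintic_D5_invariant {K : Type*} [CommRing K] (ζ : K) (hζ : ζ ^ 5 = 1)
    (a1 a2 a3 a4 a5 a6 : K) :
    (MvPolynomial.aeval
        (fun i : Fin 4 => (C (ζ ^ ((i : ℕ) + 1)) * X i : MvPolynomial (Fin 4) K))
        (barlowMatrix a1 a2 a3 a4 a5 a6).det =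
      (barlowMatrix a1 a2 a3 a4 a5 a6).det) ∧
    (MvPolynomial.aeval
        (fun i : Fin 4 => (X i.rev : MvPolynomial (Fin 4) K))
        (barlowMatrix a1 a2 a3 a4 a5 a6).det =
      (barlowMatrix a1 a2 a3 a4 a5 a6).det) := by
  constructor
  · have h : (C ζ : MvPolynomial (Fin 4) K) ^ 5 = 1 := by rw [← C_pow, hζ, C_1]
    have hd : (Matrix.diagonal
        (fun i : Fin 5 => (C ζ ^ (i : ℕ) : MvPolynomial (Fin 4) K))).det = 1 := by
      simp only [Matrix.det_diagonal, Fin.prod_univ_five]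
      change C ζ ^ 0 * C ζ ^ 1 * C ζ ^ 2 * C ζ ^ 3 * C ζ ^ 4 = 1
      linear_combination (C ζ ^ 5 + 1) * h
    rw [AlgHom.map_det, map_scale_barlowMatrix ζ hζ, Matrix.det_mul, Matrix.det_mul, hd,
      one_mul, mul_one]
  · rw [AlgHom.map_det, map_rev_barlowMatrix, Matrix.det_submatrix_equiv_self]
end
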